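/- arXiv:1504.06037 — 2 statements merged into one kernel-verified Lean document; each statement's English description precedes it below -/
import Mathlib

section
/- Let R be a Noetherian local ring which is a homomorphic image of a Cohen–Macaulay local ring, and assume Ass(R) ⊆ Assh(R) ∪ {𝔪}, where 𝔪 is the maximal ideal. Then the set ℱ = { 𝔭 ∈ Spec(R) : ht_R(𝔭) > 1 and depth(R_𝔭) = 1 } is finite. -/
open CategoryTheory IsLocalRing

noncomputable section

/-- The length of a module, defined as the Krull dimension of its submodule lattice. -/
def moduleLength (R M : Type) [CommRing R] [AddCommGroup M] [Module R M] : WithBot ℕ∞ :=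
  Order.krullDim (Submodule R M)

variable (R : Type) [CommRing R] [IsLocalRing R]

/-- `q` is a parameter ideal of the `d`-dimensional local ring `R`:
it is generated by `d` elements and is `𝔪`-primary (its radical is `𝔪`). -/
def IsParameterIdeal (d : ℕ) (q : Ideal R) : Prop :=
  (∃ x : Fin d → R, q = Ideal.span (Set.range x)) ∧ q.radical = maximalIdeal R

/-- `e` is the sequence of Hilbert coefficients of the `𝔪`-primary ideal `I`:
for all large `n`, `ℓ(R/Iⁿ⁺¹) = Σ_{i=0}^d (-1)^i e_i C(n+d-i, d-i)`. -/
def IsHilbertCoeffs (d : ℕ) (I : Ideal R) (e : ℕ → ℤ) : Prop :=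
  ∃ N : ℕ, ∀ n ≥ N, ∃ L : ℕ,
    moduleLength R (R ⧸ I ^ (n + 1)) = (L : ℕ∞) ∧
    (L : ℤ) = ∑ i ∈ Finset.range (d + 1),
      (-1 : ℤ) ^ i * e i * ((n + d - i).choose (d - i) : ℤ)

/-- The index of reducibility `𝒩(q;R) = ℓ_R((q :_R 𝔪)/q)`. -/
def indexOfReducibility (q : Ideal R) : WithBot ℕ∞ :=
  moduleLength R
    (↥(q.colon (maximalIdeal R)) ⧸ (Submodule.comap (q.colon (maximalIdeal R)).subtype q))

/-- `R` is unmixed of dimension `d`: `dim (R̂/P) = d` for every associated prime `P`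
of the `𝔪`-adic completion `R̂` of `R`. -/
def IsUnmixed (d : ℕ) : Prop :=
  ∀ P ∈ associatedPrimes (AdicCompletion (maximalIdeal R) R) (AdicCompletion (maximalIdeal R) R),
    ringKrullDim ((AdicCompletion (maximalIdeal R) R) ⧸ P) = (d : WithBot ℕ∞)

/-- The depth of a local ring `A`, as the least `i` such that `Ext^i(k, A) ≠ 0`. -/
def extDepth (A : Type) [CommRing A] [IsLocalRing A] : ℕ∞ :=
  sInf {n : ℕ∞ | ∃ m : ℕ, n = (m : ℕ∞) ∧
    Nontrivial (((Ext A (ModuleCat A) m).obj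
      (Opposite.op (ModuleCat.of A (ResidueField A)))).obj (ModuleCat.of A A))}

/-- A local ring is Cohen–Macaulay if its depth equals its Krull dimension. -/
def IsCohenMacaulay (A : Type) [CommRing A] [IsLocalRing A] : Prop :=
  (extDepth A : WithBot ℕ∞) = ringKrullDim A

/-- The Cohen–Macaulay type `r(R) = ℓ_R(Ext^d_R(R/𝔪, R))`. -/
def cmType (d : ℕ) : WithBot ℕ∞ :=
  moduleLength R (((Ext R (ModuleCat R) d).obj
      (Opposite.op (ModuleCat.of R (R ⧸ maximalIdeal R)))).obj (ModuleCat.of R R))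

/-- `f` is the sequence of coefficients of the polynomial that agrees with
`n ↦ ℓ((Iⁿ :_R 𝔪)/Iⁿ)` for all large `n`; `f 0` is the irreducible multiplicity `f₀(I)`. -/
def IsIrrCoeffs (d : ℕ) (I : Ideal R) (f : ℕ → ℤ) : Prop :=
  ∃ N : ℕ, ∀ n ≥ N, ∃ L : ℕ,
    indexOfReducibility R (I ^ n) = (L : ℕ∞) ∧
    (L : ℤ) = ∑ i ∈ Finset.range d,
      (-1 : ℤ) ^ i * f i * ((n + (d - 1) - i).choose (d - 1 - i) : ℤ)

/-- `R` is a generalized Cohen–Macaulay ring of dimension `d`: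
the local cohomology modules `H^i_𝔪(R)` have finite length for all `i < d`. -/
def IsGeneralizedCM (d : ℕ) : Prop :=
  ∀ i < d, ∃ L : ℕ,
    moduleLength R ↥((localCohomology (maximalIdeal R) i).obj (ModuleCat.of R R)) = (L : ℕ∞)

/-- `r_i(R) = dim_k ((0) :_{H^i_𝔪(R)} 𝔪)`, the length of the socle of the `i`-th
local cohomology module of `R`. -/
def socLocalCohomology (i : ℕ) : WithBot ℕ∞ :=
  moduleLength R
    ↥(Submodule.torsionBySet R ↥((localCohomology (maximalIdeal R) i).obj (ModuleCat.of R R))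
      (maximalIdeal R : Set R))

/-- A system of parameters `x₁, …, x_d` is standard if
`𝔮·H^i_𝔪(R/(x₁,…,x_j)R) = 0` for all `i + j < d`, where `𝔮 = (x₁,…,x_d)`. -/
def IsStandardSOP (d : ℕ) (x : Fin d → R) : Prop :=
  (Ideal.span (Set.range x)).radical = maximalIdeal R ∧
  ∀ i j : ℕ, i + j < d →
    ∀ a ∈ Ideal.span (Set.range x),
      ∀ v : ((localCohomology (maximalIdeal R) i).obj
        (ModuleCat.of R (R ⧸ Ideal.span (x '' {k : Fin d | (k : ℕ) < j})))), a • v = 0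

/-- `R` is a regular local ring of dimension `d`: `𝔪` is generated by `d` elements. -/
def IsRegularLocal (d : ℕ) : Prop :=
  ∃ x : Fin d → R, maximalIdeal R = Ideal.span (Set.range x)

/-- `R` is Gorenstein: `R` is Cohen–Macaulay of Cohen–Macaulay type `r(R) = 1`. -/
def IsGorenstein (d : ℕ) : Prop :=
  IsCohenMacaulay R ∧ cmType R d = 1

/-- The homology computing `Ext` from a projective resolution vanishes exactly when the
derived-category `Ext` does. -/
theorem subsingleton_ext_iff (A : Type) [CommRing A] (X Y : ModuleCat.{0} A) (n : ℕ) :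
    Subsingleton (((Ext A (ModuleCat A) n).obj (Opposite.op X)).obj Y) ↔
      Subsingleton (Abelian.Ext X Y n) := by
  obtain ⟨P⟩ := (inferInstance : HasProjectiveResolution X).out
  rw [← ModuleCat.isZero_iff_subsingleton, (P.isoExt n Y).isZero_iff,
    ← HomologicalComplex.exactAt_iff_isZero_homology]
  cases n with
  | zero =>
    rw [HomologicalComplex.exactAt_iff' _ 0 0 1 (by simp) (by simp),
      ShortComplex.moduleCat_exact_iff, Abelian.Ext.homEquiv₀.subsingleton_congr]
    constructor
    · intro h
      refine subsingleton_of_forall_eq 0 fun f ↦ ?_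
      have hd : (P.complex.d 1 0 ≫ P.π.f 0) ≫ f = 0 := by
        rw [P.complex_d_comp_π_f_zero]
        exact Limits.zero_comp
      obtain ⟨g, hg⟩ := h (P.π.f 0 ≫ f : P.complex.X 0 ⟶ Y) ((Category.assoc _ _ _).symm.trans hd)
      have hz : P.complex.d 0 0 ≫ (show P.complex.X 0 ⟶ Y from g) = 0 := by
        rw [P.complex.shape 0 0 (by simp), Limits.zero_comp]
      have hf : P.π.f 0 ≫ f = 0 := hg.symm.trans hz
      exact Limits.zero_of_epi_comp (P.π.f 0) hf
    · intro h f hf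
      refine ⟨0, ?_⟩
      rw [map_zero]
      have h0 := P.exact₀.desc' (show P.complex.X 0 ⟶ Y from f) hf
      obtain ⟨g, hg⟩ := h0
      have hg0 : g = 0 := h.elim _ _
      rw [hg0] at hg
      exact (Limits.comp_zero.symm.trans hg)
  | succ n =>
    rw [HomologicalComplex.exactAt_iff' _ n (n+1) (n+2) (by simp) (by simp),
      ShortComplex.moduleCat_exact_iff]
    constructor
    · intro h
      refine subsingleton_of_forall_eq 0 fun α ↦ ?_
      obtain ⟨f, hf, rfl⟩ := P.extMk_surjective α (n + 2) rfl
      rw [P.extMk_eq_zero_iff f (n + 2) rfl hf n rfl]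
      exact h f hf
    · intro h f hf
      exact (P.extMk_eq_zero_iff f (n + 2) rfl hf n rfl).1 (Subsingleton.elim _ _)

/-- The condition that `Extⁱ(k, M)` vanishes for all `i < n`, where `k` is the residue field. -/
def ExtVanishesBelow (A : Type) [CommRing A] [IsLocalRing A] (M : Type) [AddCommGroup M]
    [Module A M] (n : ℕ) : Prop :=
  ∀ i < n, Subsingleton
    (Abelian.Ext (ModuleCat.of A (ResidueField A)) (ModuleCat.of A M) i)

section

variable {A : Type} [CommRing A] [IsLocalRing A] {M : Type} [AddCommGroup M] [Module A M]

theorem subsingleton_ext_zero_iff :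
    Subsingleton (Abelian.Ext (ModuleCat.of A (ResidueField A)) (ModuleCat.of A M) 0) ↔
      Subsingleton (ResidueField A →ₗ[A] M) := by
  rw [Abelian.Ext.homEquiv₀.subsingleton_congr, ModuleCat.homEquiv.subsingleton_congr]

theorem maximalIdeal_mem_associatedPrimes_iff [IsNoetherianRing A] :
    maximalIdeal A ∈ associatedPrimes A M ↔ Nontrivial (ResidueField A →ₗ[A] M) := by
  rw [AssociatedPrimes.mem_iff, isAssociatedPrime_iff_exists_injective_linearMap]
  constructor
  · rintro ⟨h, f, hf⟩
    refine ⟨f, 0, fun h0 ↦ ?_⟩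
    have : (1 : ResidueField A) = 0 := hf (by rw [h0]; rfl)
    exact one_ne_zero this
  · intro h
    obtain ⟨f, hf⟩ := exists_ne (0 : ResidueField A →ₗ[A] M)
    refine ⟨inferInstance, f, (injective_iff_map_eq_zero (G := ResidueField A) f).2 ?_⟩
    intro x hx
    by_contra hx0
    obtain ⟨r, rfl⟩ := Ideal.Quotient.mk_surjective x
    have hr : IsUnit r := by
      by_contra hr
      exact hx0 (Ideal.Quotient.eq_zero_iff_mem.2 ((mem_maximalIdeal r).2 hr))
    have h1 : r • f (1 : ResidueField A) = 0 := by
      rw [← map_smul, ← hx]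
      congr 1
      rw [Algebra.smul_def, mul_one]
      rfl
    rw [hr.smul_eq_zero] at h1
    refine hf (LinearMap.ext fun z ↦ ?_)
    obtain ⟨a, rfl⟩ := Ideal.Quotient.mk_surjective z
    have h2 : (Ideal.Quotient.mk (maximalIdeal A) a : ResidueField A) =
        a • (1 : ResidueField A) := by
      rw [Algebra.smul_def, mul_one]
      rfl
    exact (congrArg f h2).trans ((map_smul f a 1).trans (by rw [h1, smul_zero]; rfl))

theorem ext_smul_eq_zero {r : A} (hr : r ∈ maximalIdeal A) {i : ℕ}
    (x : Abelian.Ext (ModuleCat.of A (ResidueField A)) (ModuleCat.of A M) i) : r • x = 0 := by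
  have h : r • 𝟙 (ModuleCat.of A (ResidueField A)) = 0 := by
    ext x
    change r • (x : ResidueField A) = 0
    rw [Algebra.smul_def, show algebraMap A (ResidueField A) r = 0 from
      Ideal.Quotient.eq_zero_iff_mem.2 hr, zero_mul]
  rw [← Abelian.Ext.mk₀_id_comp (r • x), Abelian.Ext.comp_smul, ← Abelian.Ext.smul_comp,
    ← Abelian.Ext.mk₀_smul, h]
  simp

theorem ExtVanishesBelow.quotSMulTop {n : ℕ} (h : ExtVanishesBelow A M (n + 1)) {r : A}
    (hr : IsSMulRegular M r) : ExtVanishesBelow A (QuotSMulTop r M) n := by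
  intro i hi
  refine subsingleton_of_forall_eq 0 fun x ↦ ?_
  have hs := IsSMulRegular.smulShortComplex_shortExact (M := ModuleCat.of A M) hr
  have h1 := h (i + 1) (by omega)
  have h2 := h i (by omega)
  obtain ⟨x₂, hx₂⟩ := Abelian.Ext.covariant_sequence_exact₃ _ hs x rfl
    (@Subsingleton.elim _ h1 _ _)
  obtain rfl : x₂ = 0 := @Subsingleton.elim _ h2 _ _
  rw [← hx₂]
  exact Abelian.Ext.zero_comp ..

theorem subsingleton_ext_succ_of_quotSMulTop {r : A} (hrm : r ∈ maximalIdeal A)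
    (hr : IsSMulRegular M r) {i : ℕ}
    (h : Subsingleton
      (Abelian.Ext (ModuleCat.of A (ResidueField A)) (ModuleCat.of A (QuotSMulTop r M)) i)) :
    Subsingleton (Abelian.Ext (ModuleCat.of A (ResidueField A)) (ModuleCat.of A M) (i + 1)) := by
  refine subsingleton_of_forall_eq 0 fun x ↦ ?_
  have hs := IsSMulRegular.smulShortComplex_shortExact (M := ModuleCat.of A M) hr
  have hx : x.comp (Abelian.Ext.mk₀ ((ModuleCat.of A M).smulShortComplex r).f)
      (add_zero (i + 1)) = 0 :=
    (Abelian.Ext.smul_eq_comp_mk₀ x r).symm.trans (ext_smul_eq_zero hrm x)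
  obtain ⟨x₃, rfl⟩ := Abelian.Ext.covariant_sequence_exact₁ _ hs x hx rfl
  obtain rfl : x₃ = 0 := @Subsingleton.elim _ h _ _
  exact Abelian.Ext.zero_comp ..

theorem ExtVanishesBelow.maximalIdeal_notMem [IsNoetherianRing A] {n : ℕ}
    (h : ExtVanishesBelow A M (n + 1)) : maximalIdeal A ∉ associatedPrimes A M := by
  rw [maximalIdeal_mem_associatedPrimes_iff, not_nontrivial_iff_subsingleton,
    ← subsingleton_ext_zero_iff]
  exact h 0 n.succ_pos

variable (A) in
theorem extVanishesBelow_of_le_extDepth {n : ℕ} (h : (n : ℕ∞) ≤ extDepth A) :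
    ExtVanishesBelow A A n := by
  intro i hi
  rw [← subsingleton_ext_iff, ← not_nontrivial_iff_subsingleton]
  intro hn
  have : extDepth A ≤ i := sInf_le ⟨i, rfl, hn⟩
  exact absurd (Nat.cast_le.1 (h.trans this)) (by omega)

theorem maximalIdeal_mem_associatedPrimes_quotSMulTop [IsNoetherianRing A]
    (h : extDepth A = 1) {r : A} (hrm : r ∈ maximalIdeal A) (hr : IsSMulRegular A r) :
    maximalIdeal A ∈ associatedPrimes A (QuotSMulTop r A) := by
  rw [maximalIdeal_mem_associatedPrimes_iff, ← not_subsingleton_iff_nontrivial,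
    ← subsingleton_ext_zero_iff]
  intro h0
  have h1 := subsingleton_ext_succ_of_quotSMulTop hrm hr h0
  rw [← subsingleton_ext_iff, ← not_nontrivial_iff_subsingleton] at h1
  have hne : {n : ℕ∞ | ∃ m : ℕ, n = (m : ℕ∞) ∧
    Nontrivial (((Ext A (ModuleCat A) m).obj
      (Opposite.op (ModuleCat.of A (ResidueField A)))).obj (ModuleCat.of A A))}.Nonempty := by
    by_contra he
    rw [Set.not_nonempty_iff_eq_empty] at he
    rw [extDepth, he] at h
    simp at h
  obtain ⟨m, hm, hn⟩ := csInf_mem hne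
  change extDepth A = m at hm
  rw [h] at hm
  obtain rfl : m = 1 := by exact_mod_cast hm.symm
  exact h1 hn

end

section CohenMacaulayCover

open scoped Pointwise

variable {A : Type} [CommRing A]

theorem ringKrullDim_quotient_succ_le_of_lt {P Q : Ideal A} [P.IsPrime] (h : P < Q) :
    ringKrullDim (A ⧸ Q) + 1 ≤ ringKrullDim (A ⧸ P) := by
  obtain ⟨x, hxQ, hxP⟩ := SetLike.exists_of_lt h
  refine ringKrullDim_succ_le_of_surjective (Ideal.Quotient.factor h.le)
    (Ideal.Quotient.factor_surjective h.le) (r := Ideal.Quotient.mk P x) ?_ ?_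
  · exact mem_nonZeroDivisors_of_ne_zero (mt Ideal.Quotient.eq_zero_iff_mem.1 hxP)
  · rw [Ideal.Quotient.factor_mk]
    exact Ideal.Quotient.eq_zero_iff_mem.2 hxQ

variable [IsNoetherianRing A]

theorem isSMulRegular_iff_forall_notMem {M : Type} [AddCommGroup M] [Module A M] {y : A} :
    IsSMulRegular M y ↔ ∀ Q ∈ associatedPrimes A M, y ∉ Q := by
  have h := Set.ext_iff.1 (biUnion_associatedPrimes_eq_compl_regular A M) y
  simp only [Set.mem_iUnion, Set.mem_compl_iff, SetLike.mem_coe] at h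
  change _ ↔ ¬ IsSMulRegular M y at h
  rw [← not_iff_not, ← h]
  push Not
  simp

theorem exists_mem_isSMulRegular {M : Type} [AddCommGroup M] [Module A M] [Module.Finite A M]
    {J : Ideal A} (h : ∀ Q ∈ associatedPrimes A M, ¬ J ≤ Q) : ∃ y ∈ J, IsSMulRegular M y := by
  by_contra! hJ
  have hsub : (J : Set A) ⊆ ⋃ Q ∈ associatedPrimes A M, ((id Q : Ideal A) : Set A) := by
    intro y hy
    have := mt isSMulRegular_iff_forall_notMem.2 (hJ y hy)
    push Not at this
    simpa using this
  obtain ⟨Q, hQ, hle⟩ := (Ideal.subset_union_prime_finite (associatedPrimes.finite A M) ⊥ ⊥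
    fun Q hQ _ _ ↦ hQ.isPrime).1 hsub
  exact h Q hQ hle

theorem mem_associatedPrimes_of_supportDim_le {T : Type} [AddCommGroup T] [Module A T]
    [Module.Finite A T] {d : ℕ} (hT : Module.supportDim A T ≤ d) {Q : PrimeSpectrum A}
    (hQ : Q ∈ Module.support A T) (hd : (d : WithBot ℕ∞) ≤ ringKrullDim (A ⧸ Q.asIdeal)) :
    Q.asIdeal ∈ associatedPrimes A T := by
  apply Module.associatedPrimes.minimalPrimes_annihilator_subset_associatedPrimes
  rw [Module.support_eq_zeroLocus, PrimeSpectrum.mem_zeroLocus] at hQ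
  refine ⟨⟨Q.isPrime, hQ⟩, fun P hP hle ↦ ?_⟩
  by_contra hne
  have hlt : P < Q.asIdeal := lt_of_le_not_ge hle hne
  have := hP.1
  have h1 := ringKrullDim_quotient_succ_le_of_lt hlt
  have h2 := ringKrullDim_le_of_surjective (Ideal.Quotient.factor hP.2)
    (Ideal.Quotient.factor_surjective hP.2)
  rw [Module.supportDim_eq_ringKrullDim_quotient_annihilator] at hT
  have h3 := (add_le_add_left hd 1).trans (h1.trans (h2.trans hT))
  norm_cast at h3
  omega

variable [IsLocalRing A]

theorem exists_lt_mem_associatedPrimes_quotSMulTop {M : Type} [AddCommGroup M] [Module A M]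
    [Module.Finite A M] {x : A} (hx : x ∈ maximalIdeal A) (hreg : IsSMulRegular M x)
    {P : Ideal A} (hP : P ∈ associatedPrimes A M) :
    ∃ Q ∈ associatedPrimes A (QuotSMulTop x M), P < Q := by
  obtain ⟨hPp, z₀, hz₀⟩ := isAssociatedPrime_iff.1 (AssociatedPrimes.mem_iff.1 hP)
  let N : Submodule A M := Submodule.torsionBySet A M P
  have hN : ∀ z, z ∈ N ↔ ∀ p ∈ P, p • z = 0 := fun z ↦ by
    simp [N, Submodule.mem_torsionBySet_iff]
  have hmem : z₀ ∈ N := by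
    refine (hN z₀).2 fun p hp ↦ ?_
    rw [hz₀, Submodule.mem_colon_singleton] at hp
    exact hp
  have hz₀0 : z₀ ≠ 0 := by
    rintro rfl
    refine hPp.ne_top (Ideal.eq_top_iff_one _ |>.2 ?_)
    rw [hz₀, Submodule.mem_colon_singleton, smul_zero]
    exact zero_mem _
  obtain ⟨z, hzN, hz⟩ : ∃ z ∈ N, z ∉ x • (⊤ : Submodule A M) := by
    by_contra! hle
    have hbot : N = ⊥ := by
      refine Submodule.eq_bot_of_le_smul_of_le_jacobson_bot (maximalIdeal A) N
        (IsNoetherian.noetherian N) (fun z hz ↦ ?_) (maximalIdeal_le_jacobson _)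
      obtain ⟨m, -, rfl⟩ := (Submodule.mem_smul_pointwise_iff_exists _ _ _).1 (hle z hz)
      refine Submodule.smul_mem_smul hx ((hN m).2 fun p hp ↦ hreg ?_)
      change x • p • m = x • (0 : M)
      rw [smul_comm, (hN _).1 hz p hp, smul_zero]
    rw [hbot] at hmem
    exact hz₀0 hmem
  obtain ⟨Q, hQ, hle⟩ := exists_le_isAssociatedPrime_of_isNoetherianRing A
    (Submodule.Quotient.mk z : QuotSMulTop x M) (mt (Submodule.Quotient.mk_eq_zero _).1 hz)
  refine ⟨Q, hQ, SetLike.lt_iff_le_and_exists.2 ⟨fun p hp ↦ hle ?_, x, hle ?_, ?_⟩⟩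
  · rw [Submodule.mem_colon_singleton, ← Submodule.Quotient.mk_smul, (hN z).1 hzN p hp]
    exact zero_mem _
  · rw [Submodule.mem_colon_singleton, ← Submodule.Quotient.mk_smul, Submodule.mem_bot,
      Submodule.Quotient.mk_eq_zero]
    exact Submodule.smul_mem_pointwise_smul z x ⊤ trivial
  · exact isSMulRegular_iff_forall_notMem.1 hreg P hP

theorem ExtVanishesBelow.le_ringKrullDim_quotient {n : ℕ} :
    ∀ {M : Type} [AddCommGroup M] [Module A M] [Module.Finite A M],
      ExtVanishesBelow A M n → ∀ {P : Ideal A}, P ∈ associatedPrimes A M →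
        (n : WithBot ℕ∞) ≤ ringKrullDim (A ⧸ P) := by
  induction n with
  | zero =>
    intro M _ _ _ _ P hP
    have := hP.isPrime
    exact ringKrullDim_nonneg_of_nontrivial
  | succ n ih =>
    intro M _ _ _ h P hP
    obtain ⟨x, hxm, hx⟩ := exists_mem_isSMulRegular (M := M) (J := maximalIdeal A) fun Q hQ hle ↦
      h.maximalIdeal_notMem
        ((maximalIdeal.isMaximal A).eq_of_le hQ.isPrime.ne_top hle ▸ hQ)
    obtain ⟨Q, hQ, hlt⟩ := exists_lt_mem_associatedPrimes_quotSMulTop hxm hx hP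
    have := hP.isPrime
    push_cast
    exact (add_le_add_left (ih (h.quotSMulTop hx) hQ) 1).trans
      (ringKrullDim_quotient_succ_le_of_lt hlt)

theorem exists_extVanishesBelow_cover {n : ℕ} {I : Ideal A} {d : ℕ}
    (hI : ringKrullDim (A ⧸ I) = d) :
    ∀ {M : Type} [AddCommGroup M] [Module A M] [Module.Finite A M],
      ExtVanishesBelow A M (d + n) → Module.supportDim A M ≤ (d + n : ℕ) →
      (∀ P : PrimeSpectrum A, I ≤ P.asIdeal → P ∈ Module.support A M) →
      ∃ (T : Type) (_ : AddCommGroup T) (_ : Module A T), Module.Finite A T ∧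
        ExtVanishesBelow A T d ∧ Module.supportDim A T ≤ d ∧
        ∀ P : PrimeSpectrum A, I ≤ P.asIdeal → P ∈ Module.support A T := by
  induction n with
  | zero => exact fun {M} _ _ _ h1 h2 h3 ↦ ⟨M, _, _, inferInstance, h1, h2, h3⟩
  | succ n ih =>
    intro M _ _ _ h1 h2 h3
    have hItop : I ≠ ⊤ := by
      rintro rfl
      rw [ringKrullDim_eq_bot_of_subsingleton] at hI
      exact absurd hI (by simp)
    obtain ⟨y, hyI, hy⟩ := exists_mem_isSMulRegular (M := M) (J := I) fun Q hQ hle ↦ by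
      have h := h1.le_ringKrullDim_quotient hQ
      have h' := ringKrullDim_le_of_surjective (Ideal.Quotient.factor hle)
        (Ideal.Quotient.factor_surjective hle)
      have := h.trans (h'.trans hI.le)
      norm_cast at this
      omega
    refine ih (M := QuotSMulTop y M) (h1.quotSMulTop hy) ?_ fun P hP ↦ ?_
    · have := Module.supportDim_quotSMulTop_succ_eq_supportDim hy (le_maximalIdeal hItop hyI)
      have h := this.le.trans h2
      generalize Module.supportDim A (QuotSMulTop y M) = t at h ⊢
      induction t with
      | bot => exact bot_le
      | coe t =>
        norm_cast at h ⊢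
        induction t with
        | top => simp at h
        | coe t => norm_cast at h ⊢; omega
    · rw [Module.support_quotSMulTop]
      exact ⟨h3 P hP, by simpa [PrimeSpectrum.mem_zeroLocus] using hP hyI⟩

end CohenMacaulayCover

section Devissage

open scoped Pointwise

variable {A : Type} [CommRing A]
variable {M T : Type} [AddCommGroup M] [Module A M] [AddCommGroup T] [Module A T]

theorem associatedPrimes_quotSMulTop_subset_of_isSMulRegular {K : Submodule A M} {y : A}
    (hy : IsSMulRegular (M ⧸ K) y) :
    associatedPrimes A (QuotSMulTop y M) ⊆
      associatedPrimes A (QuotSMulTop y K) ∪ associatedPrimes A (QuotSMulTop y (M ⧸ K)) := by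
  refine associatedPrimes.subset_union_of_exact (f := QuotSMulTop.map y K.subtype)
    (g := QuotSMulTop.map y K.mkQ) ?_
    (QuotSMulTop.map_exact y (LinearMap.exact_subtype_mkQ K) K.mkQ_surjective)
  rw [injective_iff_map_eq_zero]
  intro k hk
  obtain ⟨k, rfl⟩ := Submodule.Quotient.mk_surjective _ k
  rw [QuotSMulTop.map_apply_mk, Submodule.Quotient.mk_eq_zero,
    Submodule.mem_smul_pointwise_iff_exists] at hk
  obtain ⟨m, -, hm⟩ := hk
  have hmK : m ∈ K := mem_of_isSMulRegular_quotient_of_smul_mem hy (hm ▸ k.2)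
  rw [Submodule.Quotient.mk_eq_zero, Submodule.mem_smul_pointwise_iff_exists]
  exact ⟨⟨m, hmK⟩, trivial, Subtype.ext hm⟩

theorem IsAssociatedPrime.mk_mem_support [Module.Finite A M] {Q : Ideal A}
    (hQ : IsAssociatedPrime Q M) : (⟨Q, hQ.isPrime⟩ : PrimeSpectrum A) ∈ Module.support A M := by
  rw [Module.support_eq_zeroLocus]
  rw [PrimeSpectrum.mem_zeroLocus, ← Submodule.annihilator_top]
  exact hQ.annihilator_le

variable (T) in
/-- The elements that some `T`-regular scalar moves into `N`. -/
def regularSaturation (N : Submodule A M) : Submodule A M where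
  carrier := {m | ∃ s : A, IsSMulRegular T s ∧ s • m ∈ N}
  zero_mem' := ⟨1, IsSMulRegular.one T, by simp⟩
  add_mem' := by
    rintro a b ⟨s, hs, ha⟩ ⟨t, ht, hb⟩
    refine ⟨s * t, hs.mul ht, ?_⟩
    rw [smul_add]
    refine add_mem ?_ ?_
    · rw [mul_comm, mul_smul]
      exact N.smul_mem t ha
    · rw [mul_smul]
      exact N.smul_mem s hb
  smul_mem' := by
    rintro c m ⟨s, hs, hm⟩
    exact ⟨s, hs, by rw [smul_comm]; exact N.smul_mem c hm⟩

theorem mem_regularSaturation {N : Submodule A M} {m : M} :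
    m ∈ regularSaturation T N ↔ ∃ s : A, IsSMulRegular T s ∧ s • m ∈ N := Iff.rfl

theorem le_regularSaturation (N : Submodule A M) : N ≤ regularSaturation T N :=
  fun m hm ↦ ⟨1, IsSMulRegular.one T, by rwa [one_smul]⟩

theorem isSMulRegular_quotient_regularSaturation {N : Submodule A M} {s : A}
    (hs : IsSMulRegular T s) : IsSMulRegular (M ⧸ regularSaturation T N) s := by
  rw [isSMulRegular_quotient_iff_mem_of_smul_mem]
  rintro m ⟨t, ht, hm⟩
  exact ⟨t * s, ht.mul hs, by rwa [mul_smul]⟩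

variable [IsNoetherianRing A]

theorem associatedPrimes_quotSMulTop_subset_of_injective {K : Type} [AddCommGroup K] [Module A K]
    {j : K →ₗ[A] T} (hj : Function.Injective j) {y : A} (hy : IsSMulRegular T y) :
    associatedPrimes A (QuotSMulTop y K) ⊆
      associatedPrimes A (T ⧸ LinearMap.range j) ∪ associatedPrimes A (QuotSMulTop y T) := by
  have h := associatedPrimes.subset_union_of_exact
    (f := (LinearMap.ker (QuotSMulTop.map y j)).subtype) (g := QuotSMulTop.map y j)
    (Submodule.injective_subtype _) (LinearMap.exact_subtype_ker_map _)
  refine h.trans (Set.union_subset_union_left _ fun P hP ↦ ?_)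
  rw [AssociatedPrimes.mem_iff, isAssociatedPrime_iff] at hP ⊢
  obtain ⟨hPp, ⟨k, hk⟩, rfl⟩ := hP
  obtain ⟨k, rfl⟩ := Submodule.Quotient.mk_surjective _ k
  have hk' := hk
  rw [LinearMap.mem_ker, QuotSMulTop.map_apply_mk, Submodule.Quotient.mk_eq_zero,
    Submodule.mem_smul_pointwise_iff_exists] at hk'
  obtain ⟨t, -, ht⟩ := hk'
  refine ⟨hPp, Submodule.Quotient.mk t, ?_⟩
  ext a
  rw [Submodule.mem_colon_singleton, Submodule.mem_colon_singleton, Submodule.mem_bot,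
    Submodule.mem_bot, ← Submodule.Quotient.mk_smul, Submodule.Quotient.mk_eq_zero,
    LinearMap.mem_range, Subtype.ext_iff]
  change a • (Submodule.Quotient.mk k : QuotSMulTop y K) = 0 ↔ _
  rw [← Submodule.Quotient.mk_smul, Submodule.Quotient.mk_eq_zero,
    Submodule.mem_smul_pointwise_iff_exists]
  constructor
  · rintro ⟨k', -, hk'⟩
    refine ⟨k', hy ?_⟩
    change y • j k' = y • a • t
    rw [← map_smul, hk', map_smul, ← ht, smul_comm]
  · rintro ⟨k', hk'⟩
    refine ⟨k', trivial, hj ?_⟩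
    rw [map_smul, map_smul, hk', ← ht, smul_comm]

theorem exists_smul_mem_of_mem_regularSaturation [Module.Finite A M] (N : Submodule A M) :
    ∃ s : A, IsSMulRegular T s ∧ ∀ m ∈ regularSaturation T N, s • m ∈ N := by
  classical
  obtain ⟨F, hF⟩ := IsNoetherian.noetherian (regularSaturation T N)
  have key : ∀ G : Finset M, (∀ m ∈ G, m ∈ regularSaturation T N) →
      ∃ s : A, IsSMulRegular T s ∧ ∀ m ∈ G, s • m ∈ N := by
    intro G
    induction G using Finset.induction_on with
    | empty => exact fun _ ↦ ⟨1, IsSMulRegular.one T, by simp⟩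
    | insert a G _ ih =>
      intro hG
      obtain ⟨s, hs, hsG⟩ := ih fun m hm ↦ hG m (Finset.mem_insert_of_mem hm)
      obtain ⟨t, ht, hta⟩ := hG a (Finset.mem_insert_self a G)
      refine ⟨s * t, hs.mul ht, fun m hm ↦ ?_⟩
      rcases Finset.mem_insert.1 hm with rfl | hm
      · rw [mul_smul]
        exact N.smul_mem s hta
      · rw [mul_comm, mul_smul]
        exact N.smul_mem t (hsG m hm)
  obtain ⟨s, hs, hsF⟩ := key F fun m hm ↦ hF ▸ Submodule.subset_span hm
  refine ⟨s, hs, fun m hm ↦ ?_⟩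
  have hle : Submodule.span A (F : Set M) ≤ N.comap (LinearMap.lsmul A M s) :=
    Submodule.span_le.2 hsF
  exact hle (hF ▸ hm)

/-- A prime submodule `A ⧸ Q` of `M` that also embeds into `T` has a saturation embedding
into `T`. -/
theorem exists_regularSaturation_injective [Module.Finite A M]
    (hreg : ∀ s : A, IsSMulRegular T s → IsSMulRegular M s) {Q : Ideal A}
    (hQM : Q ∈ associatedPrimes A M) (hQT : Q ∈ associatedPrimes A T) :
    ∃ N : Submodule A M, N ≠ ⊥ ∧
      ∃ j : regularSaturation T N →ₗ[A] T, Function.Injective j := by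
  have hQ := hQM.isPrime
  obtain ⟨-, h, hh⟩ := (isAssociatedPrime_iff_exists_injective_linearMap Q M).1 hQM
  obtain ⟨-, g, hg⟩ := (isAssociatedPrime_iff_exists_injective_linearMap Q T).1 hQT
  obtain ⟨s, hs, hsN⟩ := exists_smul_mem_of_mem_regularSaturation (T := T) (LinearMap.range h)
  refine ⟨LinearMap.range h, ?_, g ∘ₗ (LinearEquiv.ofInjective h hh).symm.toLinearMap ∘ₗ
    (s • (regularSaturation T (LinearMap.range h)).subtype).codRestrict (LinearMap.range h)
      fun m ↦ hsN m m.2, ?_⟩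
  · rw [Ne, LinearMap.range_eq_bot]
    rintro rfl
    exact one_ne_zero (α := A ⧸ Q) (hh (by simp))
  · rw [LinearMap.coe_comp, LinearMap.coe_comp]
    refine hg.comp ((LinearEquiv.injective _).comp fun a b hab ↦ Subtype.ext (hreg s hs ?_))
    exact congrArg Subtype.val hab

theorem exists_finite_associatedPrimes_quotSMulTop_of_regular (M₀ : Type) [AddCommGroup M₀]
    [Module A M₀] [Module.Finite A M₀] [Module.Finite A T]
    (hgood : ∀ Q ∈ Module.support A M₀, ∀ Q' ∈ associatedPrimes A T, Q.asIdeal ≤ Q' →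
      Q.asIdeal ∈ associatedPrimes A T) (N : Submodule A M₀) :
    ∀ {M : Type} [AddCommGroup M] [Module A M] (f : M₀ →ₗ[A] M), Function.Surjective f →
      LinearMap.ker f = N → (∀ s : A, IsSMulRegular T s → IsSMulRegular M s) →
      ∃ E : Set (Ideal A), E.Finite ∧ ∀ y : A, IsSMulRegular T y →
        associatedPrimes A (QuotSMulTop y M) ⊆ E ∪ associatedPrimes A (QuotSMulTop y T) := by
  induction N using WellFoundedGT.induction with
  | ind N ih =>
  intro M _ _ f hf hker hreg
  have hfin : Module.Finite A M := Module.Finite.of_surjective f hf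
  rcases subsingleton_or_nontrivial M with hM | hM
  · refine ⟨∅, Set.finite_empty, fun y _ ↦ ?_⟩
    have : Subsingleton (QuotSMulTop y M) := (Submodule.mkQ_surjective _).subsingleton
    rw [associatedPrimes.eq_empty_of_subsingleton]
    exact Set.empty_subset _
  obtain ⟨Q, hQ⟩ := associatedPrimes.nonempty A M
  obtain ⟨Q', hQ', hle⟩ : ∃ Q' ∈ associatedPrimes A T, Q ≤ Q' := by
    by_contra! hcon
    obtain ⟨y, hyQ, hy⟩ := exists_mem_isSMulRegular hcon
    exact isSMulRegular_iff_forall_notMem.1 (hreg y hy) Q hQ hyQ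
  obtain ⟨L, hL, j, hj⟩ := exists_regularSaturation_injective hreg hQ
    (hgood ⟨Q, hQ.isPrime⟩ (Module.support_subset_of_surjective f hf
      (IsAssociatedPrime.mk_mem_support hQ)) Q' hQ' hle)
  let K := regularSaturation T L
  have hlt : N < LinearMap.ker (K.mkQ ∘ₗ f) := by
    rw [LinearMap.ker_comp, Submodule.ker_mkQ, ← hker]
    refine lt_of_le_of_ne (LinearMap.ker_le_comap f) fun heq ↦ hL ?_
    have h0 : K.comap f = (⊥ : Submodule A M).comap f := heq.symm
    exact le_bot_iff.1 ((le_regularSaturation L).trans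
      (Submodule.comap_injective_of_surjective hf h0).le)
  obtain ⟨E, hE, hEM⟩ := ih _ hlt (K.mkQ ∘ₗ f) (K.mkQ_surjective.comp hf) rfl
    fun s hs ↦ isSMulRegular_quotient_regularSaturation hs
  refine ⟨E ∪ associatedPrimes A (T ⧸ LinearMap.range j),
    hE.union (associatedPrimes.finite A _), fun y hy P hP ↦ ?_⟩
  rcases associatedPrimes_quotSMulTop_subset_of_isSMulRegular
    (isSMulRegular_quotient_regularSaturation hy) hP with hP | hP
  · rcases associatedPrimes_quotSMulTop_subset_of_injective hj hy hP with hP | hP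
    · exact Or.inl (Or.inr hP)
    · exact Or.inr hP
  · rcases hEM y hy hP with hP | hP
    · exact Or.inl (Or.inl hP)
    · exact Or.inr hP

theorem exists_finite_associatedPrimes_quotSMulTop [IsLocalRing A] [Module.Finite A M]
    [Module.Finite A T]
    (hgood : ∀ Q ∈ Module.support A M, ∀ Q' ∈ associatedPrimes A T, Q.asIdeal ≤ Q' →
      Q.asIdeal ∈ associatedPrimes A T)
    (hAss : ∀ Q ∈ associatedPrimes A M, Q ∈ associatedPrimes A T ∨ Q = maximalIdeal A) :
    ∃ E : Set (Ideal A), E.Finite ∧ ∀ y : A, IsSMulRegular T y →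
      associatedPrimes A (QuotSMulTop y M) ⊆ E ∪ associatedPrimes A (QuotSMulTop y T) := by
  let H : Submodule A M := regularSaturation T ⊥
  obtain ⟨E, hE, hEM⟩ := exists_finite_associatedPrimes_quotSMulTop_of_regular M hgood _
    H.mkQ H.mkQ_surjective rfl fun s hs ↦ isSMulRegular_quotient_regularSaturation hs
  refine ⟨insert (maximalIdeal A) E, hE.insert _, fun y hy P hP ↦ ?_⟩
  rcases associatedPrimes_quotSMulTop_subset_of_isSMulRegular
    (isSMulRegular_quotient_regularSaturation (N := ⊥) hy) hP with hP | hP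
  · refine Or.inl (Or.inl ?_)
    have hsupp := Module.support_subset_of_surjective (R := A) (y • (⊤ : Submodule A H)).mkQ
      (Submodule.mkQ_surjective _) (IsAssociatedPrime.mk_mem_support hP)
    rw [Module.support_eq_zeroLocus, PrimeSpectrum.mem_zeroLocus] at hsupp
    have := hP.isPrime
    obtain ⟨Q, hQ, hQP⟩ := Ideal.exists_minimalPrimes_le (J := P) hsupp
    have hQH := Module.associatedPrimes.minimalPrimes_annihilator_subset_associatedPrimes A H hQ
    rcases hAss Q (associatedPrimes.subset_of_injective H.injective_subtype hQH) with hQT | rfl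
    · obtain ⟨-, z, hz⟩ := isAssociatedPrime_iff.1 (AssociatedPrimes.mem_iff.1 hQH)
      obtain ⟨s, hs, hsz⟩ := mem_regularSaturation.1 z.2
      refine absurd ?_ (isSMulRegular_iff_forall_notMem.1 hs Q hQT)
      rw [hz, Submodule.mem_colon_singleton]
      exact Subtype.ext hsz
    · exact ((maximalIdeal.isMaximal A).eq_of_le hP.isPrime.ne_top hQP).symm
  · rcases hEM y hy hP with hP | hP
    · exact Or.inl (Or.inr hP)
    · exact Or.inr hP

end Devissage

section Descent

open scoped Pointwise

theorem mem_associatedPrimes_quotSMulTop_of_atPrime {A : Type} [CommRing A] [IsNoetherianRing A]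
    {p : Ideal A} [p.IsPrime] {y : A}
    (h : maximalIdeal (Localization.AtPrime p) ∈ associatedPrimes (Localization.AtPrime p)
      (QuotSMulTop (algebraMap A (Localization.AtPrime p) y) (Localization.AtPrime p))) :
    p ∈ associatedPrimes A (QuotSMulTop y A) := by
  let f := Algebra.linearMap A (Localization.AtPrime p)
  have heq : Submodule.localized' (Localization.AtPrime p) p.primeCompl f
      (y • (⊤ : Submodule A A)) =
      algebraMap A (Localization.AtPrime p) y • (⊤ : Submodule _ (Localization.AtPrime p)) := by
    ext z
    rw [Submodule.mem_localized', Submodule.mem_smul_pointwise_iff_exists]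
    constructor
    · rintro ⟨m, hm, s, rfl⟩
      obtain ⟨a, -, rfl⟩ := (Submodule.mem_smul_pointwise_iff_exists _ _ _).1 hm
      exact ⟨IsLocalizedModule.mk' f a s, trivial, by
        rw [algebraMap_smul, IsLocalizedModule.mk'_smul]⟩
    · rintro ⟨b, -, rfl⟩
      obtain ⟨⟨a, s⟩, rfl⟩ := IsLocalizedModule.mk'_surjective p.primeCompl f b
      exact ⟨y • a, Submodule.smul_mem_pointwise_smul a y ⊤ trivial, s, by
        rw [algebraMap_smul, IsLocalizedModule.mk'_smul]; rfl⟩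
  have h' : maximalIdeal (Localization.AtPrime p) ∈ associatedPrimes (Localization.AtPrime p)
      (Localization.AtPrime p ⧸ Submodule.localized' (Localization.AtPrime p) p.primeCompl f
        (y • (⊤ : Submodule A A))) := by
    rw [heq]
    exact h
  have := Module.associatedPrimes.comap_mem_associatedPrimes_of_mem_associatedPrimes_of_isLocalizedModule_of_fg
    p.primeCompl (Submodule.toLocalizedQuotient' (Localization.AtPrime p) p.primeCompl f
      (y • (⊤ : Submodule A A))) _ h' (IsNoetherian.noetherian _)
  have hp : (maximalIdeal (Localization.AtPrime p)).comap
      (algebraMap A (Localization.AtPrime p)) = p :=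
    IsLocalization.AtPrime.under_maximalIdeal (Localization.AtPrime p) p
  rwa [hp] at this

variable {S B : Type} [CommRing S] [CommRing B] [Algebra S B]

theorem ringKrullDim_quotient_comap (hφ : Function.Surjective (algebraMap S B)) (p : Ideal B) :
    ringKrullDim (S ⧸ p.comap (algebraMap S B)) = ringKrullDim (B ⧸ p) :=
  ringKrullDim_eq_of_ringEquiv (RingEquiv.ofBijective
    (Ideal.quotientMap p (algebraMap S B) le_rfl)
    ⟨Ideal.quotientMap_injective, Ideal.quotientMap_surjective hφ⟩)

theorem exists_comap_eq_of_mem_associatedPrimes [IsNoetherianRing S] [IsNoetherianRing B]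
    (hφ : Function.Surjective (algebraMap S B)) {Q : Ideal S} (hQ : Q ∈ associatedPrimes S B) :
    ∃ q ∈ associatedPrimes B B, q.comap (algebraMap S B) = Q := by
  obtain ⟨hQp, x, hx⟩ := isAssociatedPrime_iff.1 (AssociatedPrimes.mem_iff.1 hQ)
  have hq : ((⊥ : Submodule B B).colon {x}).comap (algebraMap S B) = Q := by
    rw [hx]
    ext a
    rw [Ideal.mem_comap, Submodule.mem_colon_singleton, Submodule.mem_colon_singleton,
      algebraMap_smul, Submodule.mem_bot, Submodule.mem_bot]
  refine ⟨(⊥ : Submodule B B).colon {x}, isAssociatedPrime_iff.2 ⟨?_, x, rfl⟩, hq⟩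
  rw [← Ideal.map_comap_of_surjective _ hφ ((⊥ : Submodule B B).colon {x}), hq]
  refine Ideal.map_isPrime_of_surjective hφ ?_
  rw [← hq]
  exact Ideal.comap_mono bot_le

theorem comap_mem_associatedPrimes_quotSMulTop [IsNoetherianRing S] [IsNoetherianRing B]
    {p : Ideal B} {y : S} (hp : p ∈ associatedPrimes B (QuotSMulTop (algebraMap S B y) B)) :
    p.comap (algebraMap S B) ∈ associatedPrimes S (QuotSMulTop y B) := by
  obtain ⟨hpp, x, hx⟩ := isAssociatedPrime_iff.1 (AssociatedPrimes.mem_iff.1 hp)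
  obtain ⟨x, rfl⟩ := Submodule.Quotient.mk_surjective _ x
  refine isAssociatedPrime_iff.2 ⟨inferInstance, Submodule.Quotient.mk x, ?_⟩
  ext a
  rw [hx, Ideal.mem_comap, Submodule.mem_colon_singleton, Submodule.mem_colon_singleton,
    Submodule.mem_bot, Submodule.mem_bot, ← Submodule.Quotient.mk_smul,
    ← Submodule.Quotient.mk_smul, Submodule.Quotient.mk_eq_zero, Submodule.Quotient.mk_eq_zero,
    Submodule.mem_smul_pointwise_iff_exists, Submodule.mem_smul_pointwise_iff_exists]
  simp only [algebraMap_smul, Submodule.mem_top, true_and]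

theorem exists_ringKrullDim_eq_natCast (A : Type) [CommRing A] [FiniteRingKrullDim A] :
    ∃ n : ℕ, ringKrullDim A = n := by
  have h1 := ringKrullDim_ne_bot (R := A)
  have h2 := ringKrullDim_ne_top (R := A)
  obtain ⟨a, ha⟩ := WithBot.ne_bot_iff_exists.1 h1
  rw [← ha] at h2 ⊢
  obtain ⟨n, rfl⟩ := ENat.ne_top_iff_exists.1 (fun h ↦ h2 (by rw [h]; rfl) : a ≠ ⊤)
  exact ⟨n, rfl⟩

theorem ringKrullDim_quotient_add_two_le {A : Type} [CommRing A] {p : PrimeSpectrum A}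
    (hp : 1 < Order.height p) : ringKrullDim (A ⧸ p.asIdeal) + 2 ≤ ringKrullDim A := by
  obtain ⟨l, hl, hlen⟩ := Order.exists_series_of_le_height p (n := 2)
    (by simpa [one_add_one_eq_two] using Order.add_one_le_of_lt hp)
  have h01 : l ⟨0, by omega⟩ < l ⟨1, by omega⟩ := l.strictMono (Fin.lt_def.2 Nat.zero_lt_one)
  have h12 : l ⟨1, by omega⟩ < p := by
    rw [← hl, RelSeries.last]
    exact l.strictMono (Fin.lt_def.2 (by simp [hlen]))
  have h1 := ringKrullDim_quotient_succ_le_of_lt (PrimeSpectrum.asIdeal_lt_asIdeal _ _ |>.2 h01)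
  have h2 := ringKrullDim_quotient_succ_le_of_lt (PrimeSpectrum.asIdeal_lt_asIdeal _ _ |>.2 h12)
  rw [← one_add_one_eq_two, ← add_assoc]
  exact (add_le_add_left h2 1).trans (h1.trans (ringKrullDim_quotient_le _))

theorem exists_cohenMacaulay_cover [IsLocalRing S] [IsNoetherianRing S] (hS : IsCohenMacaulay S)
    {I : Ideal S} {d : ℕ} (hI : ringKrullDim (S ⧸ I) = d) :
    ∃ (T : Type) (_ : AddCommGroup T) (_ : Module S T), Module.Finite S T ∧
      ExtVanishesBelow S T d ∧ Module.supportDim S T ≤ d ∧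
      ∀ P : PrimeSpectrum S, I ≤ P.asIdeal → P ∈ Module.support S T := by
  obtain ⟨n, hn⟩ := exists_ringKrullDim_eq_natCast S
  have hdn : d ≤ n := by
    have := ringKrullDim_quotient_le I
    rw [hI, hn] at this
    exact_mod_cast this
  obtain ⟨k, rfl⟩ := Nat.exists_eq_add_of_le hdn
  have hdepth : extDepth S = (d + k : ℕ) := by
    rw [IsCohenMacaulay, hn] at hS
    exact_mod_cast hS
  refine exists_extVanishesBelow_cover hI (M := S) (extVanishesBelow_of_le_extDepth S hdepth.ge)
    ?_ fun P _ ↦ ?_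
  · rw [Module.supportDim_self_eq_ringKrullDim, hn]
  · rw [Module.support_eq_zeroLocus, PrimeSpectrum.mem_zeroLocus,
      (Module.annihilator_eq_bot (R := S) (M := S)).2 inferInstance]
    exact (bot_le : (⊥ : Ideal S) ≤ P.asIdeal)

theorem mem_associatedPrimes_quotSMulTop_of_extDepth_eq_one {A : Type} [CommRing A]
    [IsNoetherianRing A] {p : PrimeSpectrum A}
    (hp : extDepth (Localization.AtPrime p.asIdeal) = 1) {y : A} (hy : y ∈ p.asIdeal)
    (hreg : ∀ q ∈ associatedPrimes A A, q ≤ p.asIdeal → y ∉ q) :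
    p.asIdeal ∈ associatedPrimes A (QuotSMulTop y A) := by
  refine mem_associatedPrimes_quotSMulTop_of_atPrime
    (maximalIdeal_mem_associatedPrimes_quotSMulTop hp ?_ ?_)
  · exact (IsLocalization.AtPrime.to_map_mem_maximal_iff _ p.asIdeal y).2 hy
  · rw [isSMulRegular_iff_forall_notMem]
    intro q hq hyq
    have h := Module.associatedPrimes.comap_mem_associatedPrimes_of_mem_associatedPrimes_of_isLocalizedModule_of_fg
      p.asIdeal.primeCompl (Algebra.linearMap A (Localization.AtPrime p.asIdeal)) q hq
      (IsNoetherian.noetherian _)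
    refine hreg _ h (fun a ha ↦ ?_) hyq
    rw [← IsLocalization.AtPrime.to_map_mem_maximal_iff (Localization.AtPrime p.asIdeal) p.asIdeal]
    exact le_maximalIdeal hq.isPrime.ne_top ha

end Descent

/-- Lemma 3.6: if `R` is a Noetherian local ring which is a homomorphic image of a
Cohen–Macaulay local ring and `Ass(R) ⊆ Assh(R) ∪ {𝔪}`, then the set of primes `𝔭` with
`ht 𝔭 > 1` and `depth R_𝔭 = 1` is finite. -/
theorem stmt_9 [IsNoetherianRing R]
    (S : Type) [CommRing S] [IsLocalRing S] [IsNoetherianRing S]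
    (hS : IsCohenMacaulay S) (φ : S →+* R) (hφ : Function.Surjective φ)
    (hAss : ∀ p ∈ associatedPrimes R R,
      ringKrullDim (R ⧸ p) = ringKrullDim R ∨ p = maximalIdeal R) :
    {p : PrimeSpectrum R | 1 < Order.height p ∧
      extDepth (Localization.AtPrime p.asIdeal) = 1}.Finite := by
  algebraize [φ]
  have : Module.Finite S R := Module.Finite.of_surjective (Algebra.linearMap S R) hφ
  obtain ⟨d, hd⟩ := exists_ringKrullDim_eq_natCast R
  have hker : ringKrullDim (S ⧸ (⊥ : Ideal R).comap (algebraMap S R)) = d := by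
    rw [ringKrullDim_quotient_comap hφ, ← hd]
    exact ringKrullDim_eq_of_ringEquiv (RingEquiv.quotientBot R)
  obtain ⟨T, _, _, _, hText, hTdim, hTsupp⟩ := exists_cohenMacaulay_cover hS hker
  have hcomap (q : Ideal R) [q.IsPrime] (hq : ringKrullDim (R ⧸ q) = ringKrullDim R) :
      q.comap (algebraMap S R) ∈ associatedPrimes S T :=
    mem_associatedPrimes_of_supportDim_le hTdim
      (Q := ⟨q.comap (algebraMap S R), inferInstance⟩) (hTsupp _ (Ideal.comap_mono bot_le))
      (by rw [ringKrullDim_quotient_comap hφ, hq, hd])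
  obtain ⟨E, hE, hER⟩ := exists_finite_associatedPrimes_quotSMulTop (A := S) (M := R) (T := T)
    (fun Q hQ Q' hQ' hle ↦ by
      refine mem_associatedPrimes_of_supportDim_le hTdim (hTsupp Q fun a ha ↦ ?_)
        ((hText.le_ringKrullDim_quotient hQ').trans (ringKrullDim_le_of_surjective
          (Ideal.Quotient.factor hle) (Ideal.Quotient.factor_surjective hle)))
      rw [Module.support_eq_zeroLocus, PrimeSpectrum.mem_zeroLocus] at hQ
      refine hQ (Module.mem_annihilator.2 fun r ↦ ?_)
      rw [Algebra.smul_def, (Ideal.mem_bot.1 (Ideal.mem_comap.1 ha)), zero_mul])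
    (fun Q hQ ↦ by
      obtain ⟨q, hq, rfl⟩ := exists_comap_eq_of_mem_associatedPrimes hφ hQ
      have := hq.isPrime
      rcases hAss q hq with h | rfl
      · exact Or.inl (hcomap q h)
      · exact Or.inr (eq_maximalIdeal (Ideal.comap_isMaximal_of_surjective _ hφ)))
  refine Set.Finite.of_injOn (f := fun p : PrimeSpectrum R ↦ p.asIdeal.comap (algebraMap S R))
    (t := insert (maximalIdeal S) E) ?_ ?_ (hE.insert _)
  · rintro p ⟨hp1, hp2⟩
    by_cases hpm : p.asIdeal = maximalIdeal R
    · refine Or.inl (eq_maximalIdeal ?_)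
      change (p.asIdeal.comap (algebraMap S R)).IsMaximal
      rw [hpm]
      exact Ideal.comap_isMaximal_of_surjective _ hφ
    have hdim := ringKrullDim_quotient_add_two_le hp1
    rw [hd, ← ringKrullDim_quotient_comap hφ] at hdim
    have : IsLocalRing (S ⧸ p.asIdeal.comap (algebraMap S R)) :=
      IsLocalRing.of_surjective' _ Ideal.Quotient.mk_surjective
    obtain ⟨e, he⟩ := exists_ringKrullDim_eq_natCast (S ⧸ p.asIdeal.comap (algebraMap S R))
    rw [he] at hdim
    norm_cast at hdim
    obtain ⟨y, hyp, hy⟩ := exists_mem_isSMulRegular (M := T)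
      (J := p.asIdeal.comap (algebraMap S R)) fun Q hQ hle ↦ by
        have h := (hText.le_ringKrullDim_quotient hQ).trans (ringKrullDim_le_of_surjective
          (Ideal.Quotient.factor hle) (Ideal.Quotient.factor_surjective hle))
        rw [he] at h
        norm_cast at h
        omega
    have hpR := mem_associatedPrimes_quotSMulTop_of_extDepth_eq_one hp2 hyp fun q hq hqp hyq ↦ by
      have := hq.isPrime
      rcases hAss q hq with h | rfl
      · exact isSMulRegular_iff_forall_notMem.1 hy _ (hcomap q h) hyq
      · exact hpm ((maximalIdeal.isMaximal R).eq_of_le p.isPrime.ne_top hqp).symm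
    rcases hER y hy (comap_mem_associatedPrimes_quotSMulTop hpR) with h | h
    · exact Or.inr h
    · obtain ⟨k, rfl⟩ : ∃ k, d = k + 1 := ⟨d - 1, by omega⟩
      have h' := (hText.quotSMulTop hy).le_ringKrullDim_quotient h
      rw [he] at h'
      norm_cast at h'
      omega
  · intro p _ q _ hpq
    exact PrimeSpectrum.ext (Ideal.comap_injective_of_surjective _ hφ hpq)

end
end

section
/- Let (R, 𝔪) be an unmixed Noetherian local ring of dimension d ≥ 2 with infinite residue field. Then for every integer n there exists a parameter ideal 𝔮 ⊆ 𝔪ⁿ such that e₁(𝔮:𝔪) − e₁(𝔮) ≤ 𝒩(𝔮;R). -/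
open CategoryTheory IsLocalRing

noncomputable section

variable (R : Type) [CommRing R] [IsLocalRing R]

section RelativeLength

variable {S : Type*} [CommRing S]

/-- The length of `(A + B) / B` for two ideals `A` and `B`. -/
def relLength (A B : Ideal S) : ℕ∞ :=
  Module.length S (Submodule.map (Submodule.mkQ B) A)

lemma relLength_eq_length_quotient (A B : Ideal S) :
    relLength A B = Module.length S (A ⧸ Submodule.comap A.subtype B) := by
  have hker : LinearMap.ker ((Submodule.mkQ B).comp A.subtype) = Submodule.comap A.subtype B := by
    rw [LinearMap.ker_comp, Submodule.ker_mkQ]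
  have hrange : LinearMap.range ((Submodule.mkQ B).comp A.subtype)
      = Submodule.map (Submodule.mkQ B) A := by
    rw [LinearMap.range_comp, Submodule.range_subtype]
  rw [relLength, ← hker, ← hrange]
  exact (LinearMap.quotKerEquivRange _).length_eq.symm

lemma length_le_of_submodule_le {M : Type*} [AddCommGroup M] [Module S M] {N P : Submodule S M}
    (h : N ≤ P) : Module.length S N ≤ Module.length S P :=
  Module.length_le_of_injective (Submodule.inclusion h) (Submodule.inclusion_injective h)

lemma relLength_le_of_mul {A C A' C' : Ideal S} (x : S)
    (hA : ∀ a ∈ A, ∃ b ∈ A', a - x * b ∈ C) (hC : ∀ c ∈ C', x * c ∈ C) :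
    relLength A C ≤ relLength A' C' := by
  let f : (S ⧸ C') →ₗ[S] (S ⧸ C) :=
    Submodule.mapQ C' C (LinearMap.lsmul S S x) (fun c hc => hC c hc)
  have hle : Submodule.map (Submodule.mkQ C) A ≤
      Submodule.map f (Submodule.map (Submodule.mkQ C') A') := by
    rintro _ ⟨a, ha, rfl⟩
    obtain ⟨b, hb, hab⟩ := hA a ha
    refine ⟨Submodule.mkQ C' b, ⟨b, hb, rfl⟩, ?_⟩
    have : Submodule.mkQ C (x * b) = Submodule.mkQ C a :=
      ((Submodule.Quotient.eq C).2 hab).symm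
    exact this
  refine (length_le_of_submodule_le hle).trans ?_
  exact Module.length_le_of_surjective
    (f.submoduleMap (Submodule.map (Submodule.mkQ C') A'))
    (LinearMap.submoduleMap_surjective _ _)

lemma relLength_mono {A A' B : Ideal S} (h : A ≤ A') : relLength A B ≤ relLength A' B :=
  length_le_of_submodule_le (Submodule.map_mono h)

lemma relLength_top (B : Ideal S) : relLength ⊤ B = Module.length S (S ⧸ B) := by
  rw [relLength, Submodule.map_top, Submodule.range_mkQ, Module.length_top]

lemma relLength_add_length_quotient {A B : Ideal S} (h : B ≤ A) :
    relLength A B + Module.length S (S ⧸ A) = Module.length S (S ⧸ B) := by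
  symm
  refine Module.length_eq_add_of_exact (Submodule.subtype (Submodule.map (Submodule.mkQ B) A))
    (Submodule.factor h) (Submodule.subtype_injective _) (Submodule.factor_surjective h) ?_
  rw [LinearMap.exact_iff, Submodule.range_subtype]
  ext y
  obtain ⟨s, rfl⟩ := Submodule.mkQ_surjective B y
  constructor
  · intro hs
    have : s ∈ A := (Submodule.Quotient.mk_eq_zero A).1 hs
    exact ⟨s, this, rfl⟩
  · rintro ⟨a, ha, hab⟩
    rw [← hab]
    exact (Submodule.Quotient.mk_eq_zero A).2 ha

lemma relLength_le_add {A C A' C' A'' C'' : Ideal S} (x : S) (hAA : A ≤ A'') (hCC : C ≤ C'')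
    (hA : ∀ a ∈ A, a ∈ C'' → ∃ b ∈ A', a - x * b ∈ C) (hC : ∀ c ∈ C', x * c ∈ C) :
    relLength A C ≤ relLength A' C' + relLength A'' C'' := by
  have hker : relLength (A ⊓ C'') C ≤ relLength A' C' :=
    relLength_le_of_mul x (fun a ha => hA a ha.1 ha.2) hC
  set W := Submodule.map (Submodule.mkQ C) A
  let g : W →ₗ[S] (S ⧸ C'') := (Submodule.factor hCC).comp W.subtype
  have hadd : Module.length S W =
      Module.length S (LinearMap.ker g) + Module.length S (LinearMap.range g) :=
    Module.length_eq_add_of_exact (LinearMap.ker g).subtype g.rangeRestrict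
      (Submodule.subtype_injective _) g.surjective_rangeRestrict
      (by rw [LinearMap.exact_iff, LinearMap.ker_rangeRestrict, Submodule.range_subtype])
  have h1 : Module.length S (LinearMap.ker g) ≤ relLength (A ⊓ C'') C := by
    rw [← (Submodule.equivMapOfInjective W.subtype (Submodule.subtype_injective W)
      (LinearMap.ker g)).length_eq.symm]
    refine length_le_of_submodule_le ?_
    rintro _ ⟨⟨_, a, ha, rfl⟩, hk, rfl⟩
    refine ⟨a, ⟨ha, ?_⟩, rfl⟩
    exact (Submodule.Quotient.mk_eq_zero C'').1 hk
  have h2 : Module.length S (LinearMap.range g) ≤ relLength A'' C'' := by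
    refine length_le_of_submodule_le ?_
    rintro _ ⟨⟨_, a, ha, rfl⟩, rfl⟩
    exact ⟨a, hAA ha, rfl⟩
  change Module.length S W ≤ _
  rw [hadd]
  exact add_le_add (h1.trans hker) h2

end RelativeLength

section BinomialGrowth

lemma choose_add_mono {n j k : ℕ} (h : j ≤ k) : (n + j).choose j ≤ (n + k).choose k := by
  rw [← Nat.choose_symm_add, ← Nat.choose_symm_add]
  exact Nat.choose_le_choose n (by omega)

lemma leadingCoeff_nonpos_of_eventually_nonpos (m : ℕ) (c : ℕ → ℤ) (M : ℕ)
    (h : ∀ n ≥ M, ∑ j ∈ Finset.range (m + 1), c j * ((n + j).choose j : ℤ) ≤ 0) : c m ≤ 0 := by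
  rcases m with _ | m
  · simpa using h M le_rfl
  by_contra! hc
  set K : ℤ := ∑ j ∈ Finset.range (m + 1), |c j|
  have hK : 0 ≤ K := Finset.sum_nonneg fun _ _ => abs_nonneg _
  set n : ℕ := M + (m + 1) * K.toNat
  have hn := h n (Nat.le_add_right _ _)
  rw [Finset.sum_range_succ] at hn
  have hlow : -(K * ((n + m).choose m : ℤ)) ≤
      ∑ j ∈ Finset.range (m + 1), c j * ((n + j).choose j : ℤ) := by
    rw [Finset.sum_mul, ← Finset.sum_neg_distrib]
    refine Finset.sum_le_sum fun j hj => ?_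
    have h1 : ((n + j).choose j : ℤ) ≤ ((n + m).choose m : ℤ) := by
      exact_mod_cast choose_add_mono (by simpa [Nat.lt_succ_iff] using hj)
    have h2 : (0 : ℤ) ≤ ((n + j).choose j : ℤ) := by positivity
    nlinarith [abs_nonneg (c j), neg_abs_le (c j)]
  have hrec : ((m + 1 : ℕ) : ℤ) * ((n + (m + 1)).choose (m + 1) : ℤ) =
      ((n + m + 1 : ℕ) : ℤ) * ((n + m).choose m : ℤ) := by
    have := Nat.add_one_mul_choose_eq (n + m) m
    push_cast [← add_assoc]
    have h' : ((n + m + 1 : ℕ) : ℤ) * ((n + m).choose m : ℤ) =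
      ((n + m + 1).choose (m + 1) : ℤ) * ((m + 1 : ℕ) : ℤ) := by exact_mod_cast this
    push_cast at h'
    linarith
  have hp : (0 : ℤ) < ((n + m).choose m : ℤ) := by
    exact_mod_cast Nat.choose_pos (by omega)
  have hbig : (m + 1 : ℤ) * K ≤ n := by
    have : (K.toNat : ℤ) = K := Int.toNat_of_nonneg hK
    simp only [n]; push_cast; rw [this]; omega
  have hq : (0 : ℤ) ≤ ((n + (m + 1)).choose (m + 1) : ℤ) := by positivity
  push_cast at hrec
  have hle : ((n + (m + 1)).choose (m + 1) : ℤ) ≤ K * ((n + m).choose m : ℤ) := by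
    nlinarith
  have hle' := mul_le_mul_of_nonneg_left hle (by positivity : (0 : ℤ) ≤ (m : ℤ) + 1)
  have hbig' := mul_le_mul_of_nonneg_right hbig hp.le
  nlinarith

lemma exists_binomial_bound (h : ℕ → ℕ → ℕ∞) (D N : ℕ) (hfin : ∀ m, h m 1 ≠ ⊤)
    (h0 : ∀ n, 1 ≤ n → h 0 n ≤ N)
    (hs : ∀ m < D, ∀ n, 1 ≤ n → h (m + 1) (n + 1) ≤ h (m + 1) n + h m (n + 1)) :
    ∀ m < D, ∃ A : ℕ, ∀ n, 1 ≤ n → h (m + 1) n ≤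
      ((N * (n + m + 1).choose (m + 1) + A * (n + m).choose m : ℕ) : ℕ∞) := by
  intro m
  induction m with
  | zero =>
    intro hD
    obtain ⟨A, hA⟩ := ENat.ne_top_iff_exists.1 (hfin 1)
    refine ⟨A, fun n hn => ?_⟩
    induction n, hn using Nat.le_induction with
    | base =>
      rw [zero_add, ← hA]
      exact_mod_cast by simp
    | succ n hn ih =>
      refine (hs 0 hD n hn).trans ((add_le_add ih (h0 _ (by omega))).trans ?_)
      norm_cast
      simp only [zero_add, add_zero, Nat.choose_one_right, Nat.choose_zero_right]
      linarith
  | succ m ihm =>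
    intro hD
    obtain ⟨A, hA⟩ := ihm (by omega)
    obtain ⟨B, hB⟩ := ENat.ne_top_iff_exists.1 (hfin (m + 2))
    refine ⟨A + B, fun n hn => ?_⟩
    induction n, hn using Nat.le_induction with
    | base =>
      rw [show m + 1 + 1 = m + 2 from rfl, ← hB]
      norm_cast
      have : 1 ≤ (1 + (m + 1)).choose (m + 1) := Nat.choose_pos (by omega)
      nlinarith
    | succ n hn ih =>
      refine (hs (m + 1) hD n hn).trans ((add_le_add ih (hA _ (by omega))).trans ?_)
      norm_cast
      have e1 : (n + 1 + (m + 1) + 1).choose (m + 1 + 1) =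
          (n + 1 + m + 1).choose (m + 1) + (n + (m + 1) + 1).choose (m + 1 + 1) := by
        rw [show n + 1 + (m + 1) + 1 = (n + m + 2) + 1 by ring, Nat.choose_succ_succ]
        grind
      have e2 : (n + 1 + (m + 1)).choose (m + 1) =
          (n + 1 + m).choose m + (n + (m + 1)).choose (m + 1) := by
        rw [show n + 1 + (m + 1) = (n + m + 1) + 1 by ring, Nat.choose_succ_succ]
        grind
      rw [e1, e2]
      nlinarith [Nat.zero_le (B * (n + 1 + m).choose m)]

end BinomialGrowth

section SquareSequences

variable {S : Type*} [CommRing S]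

/-- The partial ideals `Q i = (z 0 ^ 2, …, z (i - 1) ^ 2)`, together with ideals `U i ⊇ Q i` such
that `z i` is regular modulo `U i` and all `z j`, `j ≥ i`, multiply `U i` into `Q i`. The squares
of the `z i` then form a `d`-sequence. -/
structure IsSquareSequence (z : ℕ → S) (Q U : ℕ → Ideal S) : Prop where
  zero : Q 0 = ⊥
  succ : ∀ i, Q (i + 1) = Q i ⊔ Ideal.span {z i ^ 2}
  le : ∀ i, Q i ≤ U i
  mul_mem : ∀ i j, i ≤ j → ∀ u ∈ U i, z j * u ∈ Q i
  mem_of_mul_mem : ∀ i r, z i * r ∈ U i → r ∈ U i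

namespace IsSquareSequence

variable {z : ℕ → S} {Q U : ℕ → Ideal S} (H : IsSquareSequence z Q U)

include H

lemma mem_succ {i : ℕ} {a : S} (ha : a ∈ Q (i + 1)) : ∃ c, a - z i ^ 2 * c ∈ Q i := by
  rw [H.succ, Submodule.mem_sup] at ha
  obtain ⟨b, hb, y, hy, rfl⟩ := ha
  obtain ⟨c, rfl⟩ := Ideal.mem_span_singleton'.1 hy
  exact ⟨c, by simpa [mul_comm] using hb⟩

lemma mono : Monotone Q :=
  monotone_nat_of_le_succ fun i => by rw [H.succ]; exact le_sup_left

lemma sq_mem {i j : ℕ} (h : i < j) : z i ^ 2 ∈ Q j := by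
  refine H.mono (Nat.succ_le_of_lt h) ?_
  rw [H.succ]
  exact Submodule.mem_sup_right (Ideal.mem_span_singleton_self _)

lemma eq_span_range (d : ℕ) : Q d = Ideal.span (Set.range fun l : Fin d => z l ^ 2) := by
  refine le_antisymm ?_ (Ideal.span_le.2 (by rintro _ ⟨l, rfl⟩; exact H.sq_mem l.2))
  have (k : ℕ) (hk : k ≤ d) : Q k ≤ Ideal.span (Set.range fun l : Fin d => z l ^ 2) := by
    induction k with
    | zero => rw [H.zero]; exact bot_le
    | succ k ih =>
      rw [H.succ]
      refine sup_le (ih (by omega)) ?_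
      rw [Ideal.span_singleton_le_iff_mem]
      exact Ideal.subset_span ⟨⟨k, hk⟩, rfl⟩
  exact this d le_rfl

lemma sq_mul_mem {i j : ℕ} (h : i ≤ j) {u : S} (hu : u ∈ U i) : z j ^ 2 * u ∈ Q i := by
  rw [pow_two, mul_assoc]
  exact (Q i).mul_mem_left _ (H.mul_mem i j h u hu)

lemma mem_of_pow_mul_mem {i k : ℕ} {r : S} (h : z i ^ k * r ∈ U i) : r ∈ U i := by
  induction k with
  | zero => simpa using h
  | succ k ih =>
    refine ih (H.mem_of_mul_mem i _ ?_)
    rwa [← mul_assoc, ← pow_succ']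

lemma mem_of_mem_of_mem {i j : ℕ} (hij : i ≤ j) {a : S} (hU : a ∈ U i) (hQ : a ∈ Q j) :
    a ∈ Q i := by
  induction j, hij using Nat.le_induction with
  | base => exact hQ
  | succ j hij ih =>
    refine ih ?_
    obtain ⟨c, hc⟩ := H.mem_succ hQ
    have h1 : z j ^ 2 * a ∈ Q j := H.mono hij (H.sq_mul_mem hij hU)
    have h2 : z j ^ 4 * c ∈ Q j := by
      have := (Q j).sub_mem h1 ((Q j).mul_mem_left (z j ^ 2) hc)
      convert this using 1
      ring
    have h3 := H.sq_mul_mem le_rfl (H.mem_of_pow_mul_mem (H.le j h2))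
    have := (Q j).add_mem hc h3
    convert this using 1
    ring

lemma inf_pow_le (d n : ℕ) : ∀ i ≤ d, Q i ⊓ Q d ^ (n + 1) ≤ Q i * Q d ^ n := by
  induction n with
  | zero => intro i _; simp
  | succ n ihn =>
    intro i hi
    induction hi using Nat.decreasingInduction with
    | self => rw [← pow_succ']; exact inf_le_right
    | of_succ i hi ih =>
      intro a ha
      have h1 := ih ⟨H.mono (Nat.le_succ i) ha.1, ha.2⟩
      rw [H.succ, Ideal.sup_mul, Submodule.mem_sup] at h1
      obtain ⟨b, hb, y, hy, rfl⟩ := h1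
      obtain ⟨c, hc, rfl⟩ := Ideal.mem_span_singleton_mul.1 hy
      have hcQ : z i ^ 2 * c ∈ Q i := by
        have := (Q i).sub_mem ha.1 (Ideal.mul_le_left hb)
        simpa using this
      have hcQd : c ∈ Q d := Ideal.pow_le_self (Nat.succ_ne_zero n) hc
      have hci : c ∈ Q i :=
        H.mem_of_mem_of_mem hi.le (H.mem_of_pow_mul_mem (H.le i hcQ)) hcQd
      have h2 := ihn i hi.le ⟨hci, hc⟩
      refine Ideal.add_mem _ hb ?_
      rw [pow_succ', mul_left_comm]
      exact Ideal.mul_mem_mul (H.sq_mem hi) h2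

lemma exists_sub_mem {d n i : ℕ} (hi : i < d) {a : S} (ha : a ∈ Q (i + 1))
    (ha' : a ∈ Q d ^ (n + 1) ⊔ Q i) : ∃ c ∈ Q d ^ n, a - z i ^ 2 * c ∈ Q i := by
  obtain ⟨b, hb, b', hb', rfl⟩ := Submodule.mem_sup.1 ha'
  have hb1 : b ∈ Q (i + 1) := by
    have := (Q (i + 1)).sub_mem ha (H.mono (Nat.le_succ i) hb')
    simpa using this
  have h1 := H.inf_pow_le d n (i + 1) hi ⟨hb1, hb⟩
  rw [H.succ, Ideal.sup_mul, Submodule.mem_sup] at h1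
  obtain ⟨e, he, y, hy, rfl⟩ := h1
  obtain ⟨c, hc, rfl⟩ := Ideal.mem_span_singleton_mul.1 hy
  refine ⟨c, hc, ?_⟩
  have := (Q i).add_mem (Ideal.mul_le_left he) hb'
  convert this using 1
  ring

end IsSquareSequence

/-- The preimage of the `M`-socle of `(q ^ n + P) / (q ^ (n + 1) + P)`. -/
def gradedSocle (M q P : Ideal S) (n : ℕ) : Ideal S :=
  (q ^ n ⊔ P) ⊓ (q ^ (n + 1) ⊔ P).colon (M : Set S)

lemma mem_gradedSocle {M q P : Ideal S} {n : ℕ} {a : S} : a ∈ gradedSocle M q P n ↔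
    a ∈ q ^ n ⊔ P ∧ ∀ μ ∈ M, μ * a ∈ q ^ (n + 1) ⊔ P := by
  simp [gradedSocle, Submodule.mem_colon, mul_comm]

namespace IsSquareSequence

variable {z : ℕ → S} {Q U : ℕ → Ideal S} (H : IsSquareSequence z Q U)

include H

lemma relLength_gradedSocle_le (M : Ideal S) {d i n : ℕ} (hi : i < d) (hn : 1 ≤ n) :
    relLength (gradedSocle M (Q d) (Q i) (n + 1)) (Q d ^ (n + 2) ⊔ Q i) ≤
      relLength (gradedSocle M (Q d) (Q i) n) (Q d ^ (n + 1) ⊔ Q i) +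
      relLength (gradedSocle M (Q d) (Q (i + 1)) (n + 1)) (Q d ^ (n + 2) ⊔ Q (i + 1)) := by
  have hQ : Q i ≤ Q (i + 1) := H.mono (Nat.le_succ i)
  refine relLength_le_add (z i ^ 2) ?_ (sup_le_sup_left hQ _) ?_ ?_
  · intro a ha
    rw [mem_gradedSocle] at ha ⊢
    exact ⟨sup_le_sup_left hQ _ ha.1, fun μ hμ => sup_le_sup_left hQ _ (ha.2 μ hμ)⟩
  · intro a ha ha'
    rw [mem_gradedSocle] at ha
    obtain ⟨b, hb, e, he, rfl⟩ := Submodule.mem_sup.1 ha'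
    have he' : e ∈ Q d ^ (n + 1) ⊔ Q i := by
      have hb' : b ∈ Q d ^ (n + 1) ⊔ Q i :=
        Submodule.mem_sup_left (Ideal.pow_le_pow_right (by omega) hb)
      simpa using Ideal.sub_mem _ ha.1 hb'
    obtain ⟨c, hc, hec⟩ := H.exists_sub_mem hi he he'
    refine ⟨c, mem_gradedSocle.2 ⟨Submodule.mem_sup_left hc, fun μ hμ => ?_⟩, ?_⟩
    · have h1 : z i ^ 2 * (μ * c) ∈ Q d ^ (n + 1 + 1) ⊔ Q i := by
        have e1 := ha.2 μ hμ
        have e2 : μ * b ∈ Q d ^ (n + 1 + 1) ⊔ Q i :=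
          Submodule.mem_sup_left (Ideal.mul_mem_left _ _ hb)
        have e3 : μ * (e - z i ^ 2 * c) ∈ Q d ^ (n + 1 + 1) ⊔ Q i :=
          Submodule.mem_sup_right (Ideal.mul_mem_left _ _ hec)
        have := Ideal.sub_mem _ (Ideal.sub_mem _ e1 e2) e3
        convert this using 1
        ring
      have h2 : z i ^ 2 * (μ * c) ∈ Q (i + 1) :=
        Ideal.mul_mem_right _ _ (H.sq_mem (Nat.lt_succ_self i))
      obtain ⟨f, hf, hf'⟩ := H.exists_sub_mem hi h2 h1
      rw [← mul_sub] at hf'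
      have hu := H.mem_of_pow_mul_mem (H.le i hf')
      have hq : μ * c - f ∈ Q d :=
        Ideal.sub_mem _ (Ideal.mul_mem_left _ _ (Ideal.pow_le_self (by omega) hc))
          (Ideal.pow_le_self (by omega) hf)
      have := Submodule.add_mem_sup hf (H.mem_of_mem_of_mem hi.le hu hq)
      simpa using this
    · have := Submodule.add_mem_sup hb hec
      rwa [add_sub_assoc]
  · intro c hc
    obtain ⟨b, hb, e, he, rfl⟩ := Submodule.mem_sup.1 hc
    rw [mul_add]
    refine Submodule.add_mem_sup ?_ (Ideal.mul_mem_left _ _ he)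
    rw [pow_succ']
    exact Ideal.mul_mem_mul (H.sq_mem hi) hb

lemma succ_pow_le (i n : ℕ) : Q (i + 1) ^ n ≤ Ideal.span {(z i ^ 2) ^ n} ⊔ Q i := by
  induction n with
  | zero => simp
  | succ n ih =>
    have hle := Ideal.mul_mono ih (H.succ i).le
    rw [Ideal.sup_mul, Ideal.mul_sup, Ideal.span_singleton_mul_span_singleton, ← pow_succ,
      ← pow_succ] at hle
    have h1 : Ideal.span {(z i ^ 2) ^ n} * Q i ≤ Q i := Ideal.mul_le_right
    have h2 : Q i * (Q i ⊔ Ideal.span {z i ^ 2}) ≤ Q i := Ideal.mul_le_left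
    exact hle.trans (sup_le (sup_le (h1.trans le_sup_right) le_sup_left) (h2.trans le_sup_right))

lemma exists_sub_pow_mul_mem {i n : ℕ} {a : S} (ha : a ∈ Q (i + 1) ^ n ⊔ Q i) :
    ∃ c, a - (z i ^ 2) ^ n * c ∈ Q i := by
  have h := (sup_le (H.succ_pow_le i n) le_sup_right) ha
  obtain ⟨b, hb, e, he, rfl⟩ := Submodule.mem_sup.1 h
  obtain ⟨c, rfl⟩ := Ideal.mem_span_singleton'.1 hb
  exact ⟨c, by simpa [mul_comm] using he⟩

lemma relLength_gradedSocle_last_le (M : Ideal S) {i n : ℕ} (hz : z i ∈ M) (hn : 1 ≤ n) :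
    relLength (gradedSocle M (Q (i + 1)) (Q i) n) (Q (i + 1) ^ (n + 1) ⊔ Q i) ≤
      relLength ((Q (i + 1)).colon (M : Set S)) (Q (i + 1)) := by
  refine relLength_le_of_mul ((z i ^ 2) ^ n) ?_ ?_
  · intro a ha
    rw [mem_gradedSocle] at ha
    obtain ⟨r, hr⟩ := H.exists_sub_pow_mul_mem ha.1
    have key : ∀ μ ∈ M, ∃ c, μ * r - z i ^ 2 * c ∈ U i := by
      intro μ hμ
      obtain ⟨c, hc⟩ := H.exists_sub_pow_mul_mem (ha.2 μ hμ)
      refine ⟨c, ?_⟩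
      have := (Q i).sub_mem hc ((Q i).mul_mem_left μ hr)
      refine H.mem_of_pow_mul_mem (k := 2 * n) (H.le i ?_)
      convert this using 1
      ring
    obtain ⟨c, hc⟩ := key _ hz
    have hrc : r - z i * c ∈ U i := by
      refine H.mem_of_mul_mem i _ ?_
      convert hc using 1
      ring
    refine ⟨z i * c, ?_, ?_⟩
    · rw [Submodule.mem_colon]
      intro μ hμ
      obtain ⟨e, he⟩ := key μ hμ
      have h1 : μ * c - z i * e ∈ U i := by
        refine H.mem_of_mul_mem i _ ?_
        have := (U i).sub_mem he ((U i).mul_mem_left μ hrc)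
        convert this using 1
        ring
      have h2 := H.mono (Nat.le_succ i) (H.mul_mem i i le_rfl _ h1)
      have h3 : z i ^ 2 * e ∈ Q (i + 1) :=
        Ideal.mul_mem_right _ _ (H.sq_mem (Nat.lt_succ_self i))
      have := Ideal.add_mem _ h2 h3
      convert this using 1
      rw [smul_eq_mul]
      ring
    · refine Submodule.mem_sup_right ?_
      obtain ⟨k, rfl⟩ := Nat.exists_eq_add_of_le hn
      have h1 := (Q i).mul_mem_left ((z i ^ 2) ^ k) (H.sq_mul_mem le_rfl hrc)
      have := (Q i).add_mem hr h1
      convert this using 1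
      ring
  · intro c hc
    refine Submodule.mem_sup_left ?_
    rw [pow_succ]
    exact Ideal.mul_mem_mul (Ideal.pow_mem_pow (H.sq_mem (Nat.lt_succ_self i)) n) hc

end IsSquareSequence

end SquareSequences

section Colon

variable {S : Type*} [CommRing S] [IsLocalRing S] [IsNoetherianRing S]

lemma not_forall_isPrime_maximalIdeal_le {d : ℕ} (hht : (d : ℕ∞) ≤ (maximalIdeal S).height)
    (s : Finset S) (hs : s.card < d) (hsm : ∀ a ∈ s, a ∈ maximalIdeal S) :
    ¬ ∀ P : Ideal S, P.IsPrime → (∀ a ∈ s, a ∈ P) → maximalIdeal S ≤ P := by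
  intro h
  have hmin : maximalIdeal S ∈ (Ideal.span (s : Set S)).minimalPrimes :=
    ⟨⟨inferInstance, Ideal.span_le.2 hsm⟩,
      fun P hP _ => h P hP.1 fun a ha => hP.2 (Ideal.subset_span ha)⟩
  have := hht.trans (Ideal.height_le_card_of_mem_minimalPrimes_span_finset hmin)
  rw [Nat.cast_le] at this
  omega

/-- If the generators of the parameter ideal `q` are squares and `dim S ≥ 2`, then
`𝔪 (q : 𝔪) = 𝔪 q`. -/
lemma maximalIdeal_mul_colon_le {d : ℕ} (hd : 2 ≤ d)
    (hht : (d : ℕ∞) ≤ (maximalIdeal S).height) (z : Fin d → S) {q : Ideal S}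
    (hq : q = Ideal.span (Set.range fun l => z l ^ 2)) (hrad : q.radical = maximalIdeal S) :
    maximalIdeal S * q.colon (maximalIdeal S : Set S) ≤ maximalIdeal S * q := by
  rw [Ideal.mul_le]
  intro μ hμ a ha
  classical
  by_contra hw
  rw [Submodule.mem_colon] at ha
  have hxq (l) : z l ^ 2 ∈ q := hq ▸ Ideal.subset_span ⟨l, rfl⟩
  have hqm : q ≤ maximalIdeal S := hrad ▸ Ideal.le_radical
  have hzm (l) : z l ∈ maximalIdeal S := hrad ▸ ⟨2, hxq l⟩
  have hwq : μ * a ∈ q := by simpa [mul_comm] using ha μ hμ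
  set w := μ * a with hwdef
  have hmP {P : Ideal S} (hP : P.IsPrime) (h : ∀ l, z l ^ 2 ∈ P) : maximalIdeal S ≤ P := by
    rw [← hrad, hP.radical_le_iff, hq, Ideal.span_le]
    rintro _ ⟨l, rfl⟩
    exact h l
  obtain ⟨c, hc⟩ := (Ideal.mem_span_range_iff_exists_fun).1 (hq ▸ hwq)
  obtain ⟨i, hi⟩ : ∃ i, IsUnit (c i) := by
    by_contra! h
    refine hw ?_
    rw [← hc]
    exact Ideal.sum_mem _ fun l _ => Ideal.mul_mem_mul ((mem_maximalIdeal _).2 (h l)) (hxq l)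
  set J : Ideal S := Ideal.span ((fun l => z l ^ 2) '' {l | l ≠ i}) with hJ
  have hxJ {l} (h : l ≠ i) : z l ^ 2 ∈ J := Ideal.subset_span ⟨l, h, rfl⟩
  have hxi {K : Ideal S} (hJK : ∀ l ≠ i, z l ^ 2 ∈ K) (hwK : w ∈ K) (l) : z l ^ 2 ∈ K := by
    by_cases h : l = i
    · subst h
      rw [← Finset.add_sum_erase _ _ (Finset.mem_univ l)] at hc
      have h1 : ∑ k ∈ Finset.univ.erase l, c k * z k ^ 2 ∈ K :=
        Ideal.sum_mem _ fun k hk => Ideal.mul_mem_left _ _ (hJK k (Finset.ne_of_mem_erase hk))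
      have h2 := K.sub_mem hwK h1
      rw [← hc, add_sub_cancel_right] at h2
      exact (Ideal.unit_mul_mem_iff_mem K hi).1 h2
    · exact hJK l h
  have hqJ : q ≤ J ⊔ Ideal.span {w} := by
    rw [hq, Ideal.span_le]
    rintro _ ⟨l, rfl⟩
    exact hxi (fun l h => Submodule.mem_sup_left (hxJ h))
      (Submodule.mem_sup_right (Ideal.mem_span_singleton_self w)) l
  have hwJ (N : ℕ) : w ^ N ∉ J := by
    intro h
    refine not_forall_isPrime_maximalIdeal_le hht
      ((Finset.univ.erase i).image fun l => z l ^ 2) ?_ ?_ ?_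
    · refine Finset.card_image_le.trans_lt ?_
      rw [Finset.card_erase_of_mem (Finset.mem_univ i), Finset.card_univ, Fintype.card_fin]
      omega
    · intro b hb
      obtain ⟨l, -, rfl⟩ := Finset.mem_image.1 hb
      exact hqm (hxq l)
    · intro P hP hsP
      have hxP (l) (h : l ≠ i) : z l ^ 2 ∈ P :=
        hsP _ (Finset.mem_image_of_mem _ (Finset.mem_erase.2 ⟨h, Finset.mem_univ l⟩))
      have hJP : J ≤ P := Ideal.span_le.2 (by rintro _ ⟨l, h, rfl⟩; exact hxP l h)
      exact hmP hP (hxi hxP (hP.mem_of_pow_mem N (hJP h)))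
  let P : Ideal S :=
    { carrier := {r | ∃ N : ℕ, w ^ N * r ∈ J}
      zero_mem' := ⟨0, by simp⟩
      add_mem' := by
        rintro r s ⟨M, hM⟩ ⟨N, hN⟩
        refine ⟨M + N, ?_⟩
        have := J.add_mem (J.mul_mem_left (w ^ N) hM) (J.mul_mem_left (w ^ M) hN)
        convert this using 1
        ring
      smul_mem' := by
        rintro r s ⟨M, hM⟩
        refine ⟨M, ?_⟩
        have := J.mul_mem_left r hM
        convert this using 1
        rw [smul_eq_mul]
        ring }
  have hJP : J ≤ P := fun r hr => ⟨0, by simpa using hr⟩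
  have hwP {r : S} (h : w * r ∈ P) : r ∈ P := by
    obtain ⟨N, hN⟩ := h
    exact ⟨N + 1, by rwa [pow_succ, mul_assoc]⟩
  have haP {r : S} (h : a * r ∈ P) : r ∈ P :=
    hwP (by rw [hwdef, mul_assoc]; exact P.mul_mem_left _ h)
  have hμP {k : ℕ} {r : S} (h : μ ^ k * r ∈ P) : r ∈ P := by
    induction k with
    | zero => simpa using h
    | succ k ih =>
      refine ih (hwP ?_)
      have := P.mul_mem_left a h
      convert this using 1
      rw [hwdef]
      ring
  have hP1 : (1 : S) ∉ P := fun ⟨N, hN⟩ => hwJ N (by simpa using hN)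
  have hmμ {ν : S} (hν : ν ∈ maximalIdeal S) : ∃ t, ν - μ * t ∈ P := by
    obtain ⟨b, hb, y, hy, hby⟩ := Submodule.mem_sup.1 (hqJ (ha ν hν))
    obtain ⟨t, rfl⟩ := Ideal.mem_span_singleton'.1 hy
    refine ⟨t, haP (hJP ?_)⟩
    convert hb using 1
    rw [eq_sub_of_add_eq hby, smul_eq_mul, hwdef]
    ring
  obtain ⟨j, hj⟩ : ∃ j : Fin d, j ≠ i := by
    have : Nontrivial (Fin d) := Fin.nontrivial_iff_two_le.2 hd
    exact exists_ne i
  have hzP : z j ∈ P := by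
    by_contra hzP
    have hpow (k : ℕ) : ∃ s, z j - μ ^ k * s ∈ P := by
      induction k with
      | zero => exact ⟨z j, by simp⟩
      | succ k ih =>
        obtain ⟨s, hs⟩ := ih
        have hsm : s ∈ maximalIdeal S := by
          rw [mem_maximalIdeal]
          intro hu
          have h1 : μ ^ (2 * k) * s ^ 2 ∈ P := by
            have := P.sub_mem (hJP (hxJ hj)) (P.mul_mem_left (z j + μ ^ k * s) hs)
            convert this using 1
            ring
          exact hP1 ((Ideal.eq_top_of_isUnit_mem _ (hμP h1) (hu.pow 2)) ▸ Submodule.mem_top)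
        obtain ⟨t, ht⟩ := hmμ hsm
        refine ⟨t, ?_⟩
        have := P.add_mem hs (P.mul_mem_left (μ ^ k) ht)
        convert this using 1
        ring
    have hmem : P.mkQ (z j) ∈ (⨅ k : ℕ, maximalIdeal S ^ k • ⊤ : Submodule S (S ⧸ P)) := by
      rw [Submodule.mem_iInf]
      intro k
      obtain ⟨s, hs⟩ := hpow k
      have : P.mkQ (z j) = μ ^ k • P.mkQ s := by
        rw [← map_smul]
        exact (Submodule.Quotient.eq P).2 hs
      rw [this]
      exact Submodule.smul_mem_smul (Ideal.pow_mem_pow hμ k) Submodule.mem_top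
    rw [Ideal.iInf_pow_smul_eq_bot_of_isLocalRing _ (Ideal.IsPrime.ne_top inferInstance)] at hmem
    exact hzP ((Submodule.Quotient.mk_eq_zero P).1 hmem)
  obtain ⟨N, hN⟩ := hzP
  set J₀ : Ideal S := Ideal.span ((fun l => z l ^ 2) '' {l | l ≠ i ∧ l ≠ j})
  have hJ₀ : J ≤ J₀ ⊔ Ideal.span {z j ^ 2} := by
    rw [hJ, Ideal.span_le]
    rintro _ ⟨l, hl, rfl⟩
    by_cases h : l = j
    · exact Submodule.mem_sup_right (h ▸ Ideal.mem_span_singleton_self _)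
    · exact Submodule.mem_sup_left (Ideal.subset_span ⟨l, ⟨hl, h⟩, rfl⟩)
  obtain ⟨b, hb, y, hy, hby⟩ := Submodule.mem_sup.1 (hJ₀ (J.mul_mem_left w hN))
  obtain ⟨r, rfl⟩ := Ideal.mem_span_singleton'.1 hy
  set f := w ^ (N + 1) - z j * r with hf
  have hzf : z j * f ∈ J₀ := by
    convert hb using 1
    rw [eq_sub_of_add_eq hby, hf]
    ring
  have hfm : f ∈ maximalIdeal S :=
    Ideal.sub_mem _ (Ideal.pow_mem_of_mem _ (hqm hwq) _ (Nat.succ_pos N))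
      (Ideal.mul_mem_right _ _ (hzm j))
  refine not_forall_isPrime_maximalIdeal_le hht
    (insert (f + z j) (((Finset.univ.erase i).erase j).image fun l => z l ^ 2)) ?_ ?_ ?_
  · refine (Finset.card_insert_le _ _).trans_lt ?_
    have := Finset.card_image_le (s := (Finset.univ.erase i).erase j) (f := fun l => z l ^ 2)
    rw [Finset.card_erase_of_mem (Finset.mem_erase.2 ⟨hj, Finset.mem_univ j⟩),
      Finset.card_erase_of_mem (Finset.mem_univ i), Finset.card_univ, Fintype.card_fin] at this
    omega
  · intro b hb
    rcases Finset.mem_insert.1 hb with rfl | hb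
    · exact Ideal.add_mem _ hfm (hzm j)
    · obtain ⟨l, -, rfl⟩ := Finset.mem_image.1 hb
      exact hqm (hxq l)
  · intro P hP hsP
    have hxP (l) (h : l ≠ i ∧ l ≠ j) : z l ^ 2 ∈ P :=
      hsP _ (Finset.mem_insert_of_mem (Finset.mem_image_of_mem _
        (Finset.mem_erase.2 ⟨h.2, Finset.mem_erase.2 ⟨h.1, Finset.mem_univ l⟩⟩)))
    have hJP : J₀ ≤ P := Ideal.span_le.2 (by rintro _ ⟨l, h, rfl⟩; exact hxP l h)
    have hsum := hsP _ (Finset.mem_insert_self _ _)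
    have hzj : z j ∈ P := by
      rcases hP.mem_or_mem (hJP hzf) with h | h
      · exact h
      · simpa using P.sub_mem hsum h
    have hfP : f ∈ P := by simpa using P.sub_mem hsum hzj
    have hwP : w ∈ P := by
      refine hP.mem_of_pow_mem (N + 1) ?_
      have := P.add_mem hfP (P.mul_mem_right r hzj)
      simpa [hf] using this
    refine hmP hP (hxi (fun l hl => ?_) hwP)
    by_cases h : l = j
    · exact h ▸ P.pow_mem_of_mem hzj 2 (by norm_num)
    · exact hxP l ⟨hl, h⟩

end Colon

section Construction

variable {S : Type*} [CommRing S] [IsLocalRing S] [IsNoetherianRing S]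

lemma exists_saturation (Q : Ideal S) : ∃ (U : Ideal S) (N : ℕ), Q ≤ U ∧
    maximalIdeal S ^ N * U ≤ Q ∧ ∀ r, (∀ μ ∈ maximalIdeal S, μ * r ∈ U) → r ∈ U := by
  obtain ⟨U, ⟨hQU, N, hN⟩, hmax⟩ := set_has_maximal_iff_noetherian.2 ‹IsNoetherianRing S›
    {U : Ideal S | Q ≤ U ∧ ∃ N : ℕ, maximalIdeal S ^ N * U ≤ Q} ⟨Q, le_rfl, 0, by simp⟩
  refine ⟨U, N, hQU, hN, fun r hr => ?_⟩
  by_contra hrU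
  refine hmax (U ⊔ Ideal.span {r}) ⟨hQU.trans le_sup_left, N + 1, ?_⟩
    (left_lt_sup.2 fun h => hrU (h (Ideal.mem_span_singleton_self r)))
  have hmr : maximalIdeal S * Ideal.span {r} ≤ U := by
    rw [Ideal.mul_le]
    intro μ hμ s hs
    obtain ⟨t, rfl⟩ := Ideal.mem_span_singleton'.1 hs
    rw [mul_left_comm]
    exact Ideal.mul_mem_left U _ (hr μ hμ)
  rw [pow_succ, mul_assoc, Ideal.mul_sup]
  exact (Ideal.mul_mono_right (sup_le Ideal.mul_le_right hmr)).trans hN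

lemma exists_mem_pow_regular (Q U : Ideal S)
    (hU : ∀ r, (∀ μ ∈ maximalIdeal S, μ * r ∈ U) → r ∈ U) (K : ℕ) :
    ∃ z ∈ maximalIdeal S ^ (K + 1), (∀ r, z * r ∈ U → r ∈ U) ∧
      ∀ P ∈ Q.minimalPrimes, P ≠ maximalIdeal S → z ∉ P := by
  set A : Set (Ideal S) := associatedPrimes S (S ⧸ U) ∪ (Q.minimalPrimes \ {maximalIdeal S})
  have hAfin : A.Finite := (associatedPrimes.finite S (S ⧸ U)).union
    ((Ideal.finite_minimalPrimes_of_isNoetherianRing S Q).subset Set.sdiff_subset)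
  have hAprime : ∀ P ∈ A, P.IsPrime := by
    rintro P (hP | hP)
    · exact hP.isPrime
    · exact hP.1.1.1
  have hAm : ∀ P ∈ A, ¬ maximalIdeal S ≤ P := by
    rintro P hPA hle
    have hPm := ((maximalIdeal.isMaximal S).eq_of_le (hAprime P hPA).ne_top hle).symm
    rcases hPA with hP | hP
    · obtain ⟨hpr, x, hx⟩ := isAssociatedPrime_iff.1 hP
      obtain ⟨r, rfl⟩ := Submodule.mkQ_surjective U x
      have hrU : r ∈ U := by
        refine hU r fun μ hμ => ?_
        have h1 := hle hμ
        rw [hx, Submodule.mem_colon_singleton] at h1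
        exact (Submodule.Quotient.mk_eq_zero U).1 h1
      have h0 : U.mkQ r = 0 := (Submodule.Quotient.mk_eq_zero U).2 hrU
      refine hpr.ne_top ?_
      rw [hx, h0, Ideal.eq_top_iff_one, Submodule.mem_colon_singleton]
      simp
    · exact hP.2 hPm
  obtain ⟨z, hz, hzA⟩ : ∃ z ∈ maximalIdeal S, ∀ P ∈ A, z ∉ P := by
    by_contra! h
    have hsub : (maximalIdeal S : Set S) ⊆ ⋃ P ∈ A, (P : Set S) := by
      intro z hz
      obtain ⟨P, hP, hzP⟩ := h z hz
      exact Set.mem_biUnion hP hzP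
    obtain ⟨P, hP, hle⟩ := (Ideal.subset_union_prime_finite hAfin (f := id) ⊤ ⊤
      fun P hP _ _ => hAprime P hP).1 hsub
    exact hAm P hP hle
  have hreg : ∀ r, z * r ∈ U → r ∈ U := by
    intro r hr
    by_contra hrU
    have : z ∈ ⋃ P ∈ associatedPrimes S (S ⧸ U), (P : Set S) := by
      rw [biUnion_associatedPrimes_eq_zero_divisors]
      exact ⟨U.mkQ r, fun h => hrU ((Submodule.Quotient.mk_eq_zero U).1 h),
        (Submodule.Quotient.mk_eq_zero U).2 hr⟩
    obtain ⟨P, hP, hzP⟩ := Set.mem_iUnion₂.1 this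
    exact hzA P (Or.inl hP) hzP
  refine ⟨z ^ (K + 1), Ideal.pow_mem_pow hz _, fun r hr => ?_, fun P hP hPm h =>
    hzA P (Or.inr ⟨hP, hPm⟩) (hP.1.1.mem_of_pow_mem _ h)⟩
  generalize K + 1 = k at hr
  induction k with
  | zero => simpa using hr
  | succ k ih => exact ih (hreg _ (by rwa [← mul_assoc, ← pow_succ']))

lemma exists_isSquareSequence (n : ℕ) : ∃ (z : ℕ → S) (Q U : ℕ → Ideal S),
    IsSquareSequence z Q U ∧ (∀ i, z i ∈ maximalIdeal S ^ (n + 1)) ∧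
      ∀ i, ∀ P ∈ (Q i).minimalPrimes, P ≠ maximalIdeal S → z i ∉ P := by
  choose U N hQU hNU hsat using exists_saturation (S := S)
  choose Z hZm hZU hZP using fun (Q : Ideal S) (K : ℕ) =>
    exists_mem_pow_regular Q (U Q) (hsat Q) K
  let st : ℕ → Ideal S × ℕ := fun k => Nat.rec (⊥, n + N ⊥) (fun _ s =>
    (s.1 ⊔ Ideal.span {Z s.1 s.2 ^ 2}, s.2 + N (s.1 ⊔ Ideal.span {Z s.1 s.2 ^ 2}))) k
  have hst (k) : st (k + 1) = ((st k).1 ⊔ Ideal.span {Z (st k).1 (st k).2 ^ 2},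
    (st k).2 + N ((st k).1 ⊔ Ideal.span {Z (st k).1 (st k).2 ^ 2})) := rfl
  have hmono : Monotone fun k => (st k).2 :=
    monotone_nat_of_le_succ fun k => by simp only [hst]; exact Nat.le_add_right _ _
  have hN (k) : N (st k).1 ≤ (st k).2 := by
    cases k with
    | zero => exact Nat.le_add_left _ _
    | succ k => rw [hst]; exact Nat.le_add_left _ _
  have hn (k) : n ≤ (st k).2 := (Nat.le_add_right n (N ⊥)).trans (hmono (Nat.zero_le k))
  refine ⟨fun k => Z (st k).1 (st k).2, fun k => (st k).1, fun k => U (st k).1,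
    ⟨rfl, fun i => rfl, fun i => hQU _, fun i j hij u hu => ?_, fun i r hr => hZU _ _ r hr⟩,
    fun i => Ideal.pow_le_pow_right (Nat.succ_le_succ (hn i)) (hZm _ _), fun i => hZP _ _⟩
  exact hNU _ (Ideal.mul_mem_mul
    (Ideal.pow_le_pow_right (((hN i).trans (hmono hij)).trans (Nat.le_succ _)) (hZm _ _)) hu)

namespace IsSquareSequence

variable {z : ℕ → S} {Q U : ℕ → Ideal S} (H : IsSquareSequence z Q U)

include H

lemma le_height (hz : ∀ i, ∀ P ∈ (Q i).minimalPrimes, P ≠ maximalIdeal S → z i ∉ P) {d : ℕ}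
    (hht : (d : ℕ∞) ≤ (maximalIdeal S).height) (i : ℕ) (hi : i ≤ d) (P : Ideal S) [P.IsPrime]
    (hP : Q i ≤ P) : (i : ℕ∞) ≤ P.height := by
  induction i generalizing P with
  | zero => simp
  | succ i ih =>
    obtain ⟨P', hP', hle⟩ := Ideal.exists_minimalPrimes_le ((H.mono (Nat.le_succ i)).trans hP)
    have hpr : P'.IsPrime := hP'.1.1
    by_cases hm : P' = maximalIdeal S
    · have : P = maximalIdeal S :=
        ((maximalIdeal.isMaximal S).eq_of_le (Ideal.IsPrime.ne_top inferInstance) (hm ▸ hle)).symm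
      rw [this]
      exact (Nat.cast_le.2 hi).trans hht
    · have hzP : z i ∈ P :=
        Ideal.IsPrime.mem_of_pow_mem inferInstance 2 (hP (H.sq_mem (Nat.lt_succ_self i)))
      have hlt : P' < P := lt_of_le_of_ne hle fun h => hz i P' hP' hm (h ▸ hzP)
      have h1 := Ideal.height_strict_mono_of_isPrime_of_isPrime hlt
      have h2 := ih (by omega) P' hP'.1.2
      push_cast
      exact (add_le_add_left h2 1).trans (Order.add_one_le_of_lt h1)

lemma radical_eq (hz : ∀ i, ∀ P ∈ (Q i).minimalPrimes, P ≠ maximalIdeal S → z i ∉ P)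
    (hzm : ∀ i, z i ∈ maximalIdeal S) {d : ℕ} (hht : (maximalIdeal S).height = d) :
    (Q d).radical = maximalIdeal S := by
  have hle : Q d ≤ maximalIdeal S := by
    rw [H.eq_span_range, Ideal.span_le]
    rintro _ ⟨l, rfl⟩
    exact Ideal.pow_mem_of_mem _ (hzm l) 2 (by norm_num)
  refine le_antisymm ((Ideal.IsPrime.radical_le_iff inferInstance).2 hle) ?_
  rw [Ideal.radical_eq_sInf]
  refine le_sInf fun P hP => ?_
  have hpr : P.IsPrime := hP.2
  have h := H.le_height hz hht.ge d le_rfl P hP.1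
  by_contra hmP
  have hlt : P < maximalIdeal S :=
    lt_of_le_of_ne (le_maximalIdeal hpr.ne_top) fun h => hmP h.ge
  have h1 := Ideal.height_strict_mono_of_isPrime_of_isPrime hlt
  exact absurd (h.trans_lt h1) (by simp [hht])

end IsSquareSequence

end Construction

section Comparison

variable {S : Type*} [CommRing S]

lemma pow_colon_le_gradedSocle {M q : Ideal S} (hle : q.colon (M : Set S) ≤ M)
    (hmul : M * q.colon (M : Set S) ≤ M * q) (n : ℕ) :
    q.colon (M : Set S) ^ (n + 1) ≤ gradedSocle M q ⊥ n := by
  have hpow (k : ℕ) : M * q.colon (M : Set S) ^ k ≤ M * q ^ k := by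
    induction k with
    | zero => simp
    | succ k ih =>
      rw [pow_succ, pow_succ, ← mul_assoc]
      refine (Ideal.mul_mono_left ih).trans ?_
      rw [mul_right_comm, mul_comm (q ^ k) q, ← mul_assoc]
      exact Ideal.mul_mono_left hmul
  have h1 : q.colon (M : Set S) ^ (n + 1) ≤ q ^ n := by
    rw [pow_succ']
    exact (Ideal.mul_mono_left hle).trans ((hpow n).trans Ideal.mul_le_right)
  intro a ha
  rw [mem_gradedSocle, sup_bot_eq, sup_bot_eq]
  exact ⟨h1 ha, fun μ hμ => Ideal.mul_le_right (hpow (n + 1) (Ideal.mul_mem_mul hμ ha))⟩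

/-- Up to a term of order `n ^ e`, the lengths of `S/qⁿ⁺¹` and `S/(q : M)ⁿ⁺¹` differ by at most
`N * (n + e + 1).choose (e + 1)`, where `N` bounds the length of `(q : M)/q`. -/
lemma IsSquareSequence.exists_length_quotient_le {z : ℕ → S} {Q U : ℕ → Ideal S}
    (H : IsSquareSequence z Q U) {M : Ideal S} {e N : ℕ} (hz : ∀ i, z i ∈ M)
    (hle : (Q (e + 2)).colon (M : Set S) ≤ M)
    (hmul : M * (Q (e + 2)).colon (M : Set S) ≤ M * Q (e + 2))
    (hfin : Module.length S (S ⧸ Q (e + 2) ^ 2) ≠ ⊤)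
    (hN : relLength ((Q (e + 2)).colon (M : Set S)) (Q (e + 2)) ≤ N) :
    ∃ A : ℕ, ∀ n, 1 ≤ n → Module.length S (S ⧸ Q (e + 2) ^ (n + 1)) ≤
      ((N * (n + (e + 1)).choose (e + 1) + A * (n + e).choose e : ℕ) : ℕ∞) +
        Module.length S (S ⧸ (Q (e + 2)).colon (M : Set S) ^ (n + 1)) := by
  have hqI : Q (e + 2) ≤ (Q (e + 2)).colon (M : Set S) := Ideal.le_colon
  have key := exists_binomial_bound
    (fun m n => relLength (gradedSocle M (Q (e + 2)) (Q (e + 1 - m)) n)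
      (Q (e + 2) ^ (n + 1) ⊔ Q (e + 1 - m))) (e + 1) N ?_ ?_ ?_ e (Nat.lt_succ_self e)
  · obtain ⟨A, hA⟩ := key
    refine ⟨A, fun n hn => ?_⟩
    rw [← relLength_add_length_quotient (Ideal.pow_right_mono hqI (n + 1))]
    gcongr
    refine (relLength_mono (pow_colon_le_gradedSocle hle hmul n)).trans ?_
    have := hA n hn
    simpa [H.zero, add_assoc] using this
  · refine fun m => ne_top_of_le_ne_top hfin ?_
    refine (relLength_mono le_top).trans ?_
    rw [relLength_top]
    exact Module.length_le_of_surjective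
      (Submodule.factor (show Q (e + 2) ^ 2 ≤ Q (e + 2) ^ (1 + 1) ⊔ Q (e + 1 - m) from le_sup_left))
      (Submodule.factor_surjective _)
  · exact fun n hn => (H.relLength_gradedSocle_last_le M (hz _) hn).trans hN
  · intro m hm n hn
    have := H.relLength_gradedSocle_le M (d := e + 2) (i := e + 1 - (m + 1)) (by omega) hn
    rwa [show e + 1 - (m + 1) + 1 = e + 1 - m by omega] at this

lemma coeff_one_le_of_eventually_le {e N A : ℕ} {a b : ℕ → ℤ} {M : ℕ}
    (hlow : ∀ n ≥ M, ∑ i ∈ Finset.range (e + 3),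
      (-1 : ℤ) ^ i * a i * ((n + (e + 2) - i).choose (e + 2 - i) : ℤ) ≤
      ∑ i ∈ Finset.range (e + 3), (-1 : ℤ) ^ i * b i * ((n + (e + 2) - i).choose (e + 2 - i) : ℤ))
    (hup : ∀ n ≥ M, ∑ i ∈ Finset.range (e + 3),
      (-1 : ℤ) ^ i * b i * ((n + (e + 2) - i).choose (e + 2 - i) : ℤ) ≤
      (N * (n + (e + 1)).choose (e + 1) + A * (n + e).choose e : ℕ) +
      ∑ i ∈ Finset.range (e + 3), (-1 : ℤ) ^ i * a i * ((n + (e + 2) - i).choose (e + 2 - i) : ℤ)) :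
    a 1 - b 1 ≤ N := by
  set δ : ℕ → ℤ := fun j => (-1 : ℤ) ^ (e + 2 - j) * (b (e + 2 - j) - a (e + 2 - j)) with hδ
  have hsum (n : ℕ) : ∑ i ∈ Finset.range (e + 3),
      (-1 : ℤ) ^ i * b i * ((n + (e + 2) - i).choose (e + 2 - i) : ℤ) -
      ∑ i ∈ Finset.range (e + 3), (-1 : ℤ) ^ i * a i * ((n + (e + 2) - i).choose (e + 2 - i) : ℤ) =
      ∑ j ∈ Finset.range (e + 3), δ j * ((n + j).choose j : ℤ) := by
    rw [← Finset.sum_sub_distrib, ← Finset.sum_range_reflect]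
    refine Finset.sum_congr rfl fun j hj => ?_
    have hj' : j ≤ e + 2 := by simpa [Nat.lt_succ_iff] using hj
    rw [show e + 3 - 1 - j = e + 2 - j by omega, show e + 2 - (e + 2 - j) = j by omega,
      show n + (e + 2) - (e + 2 - j) = n + j by omega, hδ]
    ring
  set c : ℕ → ℤ := fun j => δ j - (if j = e + 1 then (N : ℤ) else 0) - if j = e then (A : ℤ) else 0
    with hc
  have hcsum (k n : ℕ) (hk : e + 2 ≤ k) : ∑ j ∈ Finset.range k, c j * ((n + j).choose j : ℤ) =
      ∑ j ∈ Finset.range k, δ j * ((n + j).choose j : ℤ) -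
      (N * (n + (e + 1)).choose (e + 1) + A * (n + e).choose e : ℕ) := by
    simp only [hc, sub_mul, ite_mul, zero_mul, Finset.sum_sub_distrib]
    rw [Finset.sum_ite_eq', Finset.sum_ite_eq', if_pos (Finset.mem_range.2 (by omega)),
      if_pos (Finset.mem_range.2 (by omega))]
    push_cast
    ring
  have hδ0 : 0 ≤ δ (e + 2) := by
    have := leadingCoeff_nonpos_of_eventually_nonpos (e + 2) (fun j => -δ j) M fun n hn => by
      simp only [neg_mul, Finset.sum_neg_distrib]
      rw [← hsum]
      linarith [hlow n hn]
    linarith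
  have hδ1 : δ (e + 2) ≤ 0 := by
    have := leadingCoeff_nonpos_of_eventually_nonpos (e + 2) c M fun n hn => by
      rw [hcsum _ _ (by omega), ← hsum]
      linarith [hup n hn]
    simpa [hc] using this
  have hδz := le_antisymm hδ1 hδ0
  have := leadingCoeff_nonpos_of_eventually_nonpos (e + 1) c M fun n hn => by
    rw [hcsum _ _ le_rfl]
    have h1 := hup n hn
    have h2 := hsum n
    rw [Finset.sum_range_succ (fun j => δ j * ((n + j).choose j : ℤ)) (e + 2), hδz, zero_mul,
      add_zero] at h2
    linarith
  simp [hc, hδ] at this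
  linarith

end Comparison

lemma colon_maximalIdeal_le {S : Type*} [CommRing S] [IsLocalRing S] [IsNoetherianRing S]
    (hht : 0 < (maximalIdeal S).height) {q : Ideal S} (hq : q ≤ maximalIdeal S)
    (hmul : maximalIdeal S * q.colon (maximalIdeal S : Set S) ≤ maximalIdeal S * q) :
    q.colon (maximalIdeal S : Set S) ≤ maximalIdeal S := by
  refine le_maximalIdeal fun htop => ?_
  rw [htop, Ideal.mul_top] at hmul
  have hbot : maximalIdeal S = ⊥ :=
    Submodule.eq_bot_of_le_smul_of_le_jacobson_bot (maximalIdeal S) _ (IsNoetherian.noetherian _)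
      (hmul.trans (Ideal.mul_mono_right hq)) (maximalIdeal_le_jacobson _)
  have hdom : IsDomain S := by
    have : (⊥ : Ideal S).IsPrime := hbot ▸ (inferInstance : (maximalIdeal S).IsPrime)
    exact IsDomain.of_bot_isPrime S
  rw [hbot, Ideal.height_bot] at hht
  exact lt_irrefl _ hht

lemma moduleLength_eq_natCast_iff (S M : Type) [CommRing S] [AddCommGroup M] [Module S M] (L : ℕ) :
    moduleLength S M = ((L : ℕ∞) : WithBot ℕ∞) ↔ Module.length S M = L := by
  rw [moduleLength, ← Module.coe_length, WithBot.coe_inj]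

/-- Corollary 3.7: for an unmixed Noetherian local ring of dimension `d ≥ 2` with infinite
residue field, for every integer `n` there is a parameter ideal `𝔮 ⊆ 𝔪ⁿ` with
`e₁(𝔮:𝔪) - e₁(𝔮) ≤ 𝒩(𝔮;R)`. -/
theorem stmt_10 [IsNoetherianRing R] (d : ℕ)
    (hdim : ringKrullDim R = (d : WithBot ℕ∞)) (hd : 2 ≤ d)
    (hres : Infinite (ResidueField R)) (hunmixed : IsUnmixed R d) :
    ∀ n : ℕ, ∃ q : Ideal R, IsParameterIdeal R d q ∧ q ≤ maximalIdeal R ^ n ∧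
      ∀ eI eQ : ℕ → ℤ, IsHilbertCoeffs R d (q.colon (maximalIdeal R)) eI →
        IsHilbertCoeffs R d q eQ →
        ∀ Nq : ℕ, indexOfReducibility R q = (Nq : ℕ∞) → eI 1 - eQ 1 ≤ (Nq : ℤ) := by
  obtain ⟨e, rfl⟩ := Nat.exists_eq_add_of_le' hd
  intro n
  obtain ⟨z, Q, U, H, hzn, hzP⟩ := exists_isSquareSequence (S := R) n
  have hht : (maximalIdeal R).height = ((e + 2 : ℕ) : ℕ∞) := by
    rw [← WithBot.coe_inj, maximalIdeal_height_eq_ringKrullDim, hdim]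
    rfl
  have hzm (i) : z i ∈ maximalIdeal R := Ideal.pow_le_self (Nat.succ_ne_zero n) (hzn i)
  have hrad := H.radical_eq hzP hzm hht
  have hqm : Q (e + 2) ≤ maximalIdeal R := hrad ▸ Ideal.le_radical
  have hspan := H.eq_span_range (e + 2)
  refine ⟨Q (e + 2), ⟨⟨_, hspan⟩, hrad⟩, ?_, ?_⟩
  · rw [hspan, Ideal.span_le]
    rintro _ ⟨l, rfl⟩
    exact Ideal.pow_mem_of_mem _ (Ideal.pow_le_pow_right (Nat.le_succ n) (hzn l)) 2 two_pos
  rintro eI eQ ⟨M₁, hI⟩ ⟨M₂, hQ⟩ N hN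
  have hmul := maximalIdeal_mul_colon_le hd hht.ge (fun l : Fin (e + 2) => z l) hspan hrad
  have hle := colon_maximalIdeal_le (by rw [hht]; exact_mod_cast Nat.succ_pos _) hqm hmul
  have hfin : Module.length R (R ⧸ Q (e + 2) ^ 2) ≠ ⊤ := by
    obtain ⟨L, hL, -⟩ := hQ (M₂ + 1) (Nat.le_succ M₂)
    rw [moduleLength_eq_natCast_iff] at hL
    refine ne_top_of_le_ne_top (hL ▸ ENat.natCast_ne_top L) (Module.length_le_of_surjective
      (Submodule.factor (Ideal.pow_le_pow_right (by omega))) (Submodule.factor_surjective _))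
  rw [indexOfReducibility, moduleLength_eq_natCast_iff, ← relLength_eq_length_quotient] at hN
  obtain ⟨A, hA⟩ := H.exists_length_quotient_le hzm hle hmul hfin hN.le
  have hqI : Q (e + 2) ≤ (Q (e + 2)).colon (maximalIdeal R : Set R) := Ideal.le_colon
  refine coeff_one_le_of_eventually_le (e := e) (a := eI) (b := eQ) (A := A) (M := M₁ + M₂ + 1)
    ?_ ?_
  all_goals
    intro k hk
    obtain ⟨L₁, hL₁, e₁⟩ := hI k (by omega)
    obtain ⟨L₂, hL₂, e₂⟩ := hQ k (by omega)
    rw [moduleLength_eq_natCast_iff] at hL₁ hL₂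
    rw [← e₁, ← e₂]
  · have := Module.length_le_of_surjective
      (Submodule.factor (Ideal.pow_right_mono hqI (k + 1)))
      (Submodule.factor_surjective _)
    rw [hL₁, hL₂] at this
    exact_mod_cast this
  · have := hA k (by omega)
    rw [hL₁, hL₂] at this
    exact_mod_cast this

end
end
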